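/- Let B_t = R/I_t(φ) be standard determinantal of codimension c = 3, M = coker(φ*), and ℓ₃ := Σ_{j=1}^{t+2} a_j − Σ_{i=1}^{t} b_i. Then Ext¹_R(I_t(φ), B_t) ≅ Ext²_R(I_t(φ), I_t(φ)) ≅ S₂M(ℓ₃) ⊗_R I_t(φ) as graded R-modules. -/

import Mathlib

/-!
Common setup for formalizing "Schur powers of the cokernel of a graded morphism"
by J.O. Kleppe and R.M. Miró-Roig.
-/

open Matrix TensorProduct CategoryTheory

noncomputable section

namespace KMR

/-- The standard graded polynomial ring `R = k[x₀,…,xₙ]`. -/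
abbrev RR (k : Type) [Field k] (n : ℕ) : Type := MvPolynomial (Fin (n + 1)) k

variable {k : Type} [Field k] {n : ℕ}

/-- The irrelevant maximal ideal `𝔪 = (x₀,…,xₙ)`. -/
def mxI (k : Type) [Field k] (n : ℕ) : Ideal (RR k n) :=
  Ideal.span (Set.range MvPolynomial.X)

/-- The ideal `I_j(A)` generated by the `j × j` minors of the matrix `A`. -/
def minors {g t : ℕ} (A : Matrix (Fin g) (Fin t) (RR k n)) (j : ℕ) : Ideal (RR k n) :=
  Ideal.span {m | ∃ (r : Fin j → Fin g) (c : Fin j → Fin t),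
    Function.Injective r ∧ Function.Injective c ∧ m = (A.submatrix r c).det}

/-- The matrix `A` represents a graded morphism `φ : F = ⊕ R(bⱼ) → G = ⊕ R(aᵢ)`,
i.e. each entry `A i j` is homogeneous of degree `aᵢ - bⱼ` (or zero). -/
def IsHomogMatrix {g t : ℕ} (A : Matrix (Fin g) (Fin t) (RR k n))
    (a : Fin g → ℤ) (b : Fin t → ℤ) : Prop :=
  ∀ i j, A i j = 0 ∨ ∃ d : ℕ, (d : ℤ) = a i - b j ∧ (A i j).IsHomogeneous d

/-- The morphism `φ` is minimal, i.e. `φ(F) ⊆ 𝔪 G`: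
all entries of a representing matrix have vanishing constant term. -/
def IsMinMatrix {g t : ℕ} (A : Matrix (Fin g) (Fin t) (RR k n)) : Prop :=
  ∀ i j, MvPolynomial.constantCoeff (A i j) = 0

/-- `depthGE J N d` : there is an `N`-regular sequence of length `d` inside `J`,
i.e. `depth_J N ≥ d`. -/
def depthGE {R : Type} [CommRing R] (J : Ideal R) (N : Type) [AddCommGroup N] [Module R N]
    (d : ℕ) : Prop :=
  ∃ rs : List R, rs.length = d ∧ (∀ x ∈ rs, x ∈ J) ∧ RingTheory.Sequence.IsRegular N rs

/-- `depthEQ J N d` : the length of a maximal `N`-regular sequence in `J` is exactly `d`. -/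
def depthEQ {R : Type} [CommRing R] (J : Ideal R) (N : Type) [AddCommGroup N] [Module R N]
    (d : ℕ) : Prop :=
  depthGE J N d ∧ ¬ depthGE J N (d + 1)

/-- The morphism `φ : F → G` of free modules represented by the matrix `A`. -/
def phi {g t : ℕ} (A : Matrix (Fin g) (Fin t) (RR k n)) :
    (Fin t → RR k n) →ₗ[RR k n] (Fin g → RR k n) := A.mulVecLin

/-- The dual morphism `φ* : G* → F*`, represented by the transposed matrix. -/
def phiStar {g t : ℕ} (A : Matrix (Fin g) (Fin t) (RR k n)) :
    (Fin g → RR k n) →ₗ[RR k n] (Fin t → RR k n) := A.transpose.mulVecLin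

/-- `M = coker (φ*)`. -/
abbrev Mdl {g t : ℕ} (A : Matrix (Fin g) (Fin t) (RR k n)) : Type :=
  (Fin t → RR k n) ⧸ LinearMap.range (phiStar A)

/-- The canonical projection `F* → M = coker φ*`. -/
def MdlProj {g t : ℕ} (A : Matrix (Fin g) (Fin t) (RR k n)) :
    (Fin t → RR k n) →ₗ[RR k n] Mdl A :=
  Submodule.mkQ _

/-- The `i`-th symmetric power of a module, as a quotient of the `i`-th tensor power. -/
abbrev SymPow (R : Type) [CommRing R] (M : Type) [AddCommGroup M] [Module R M] (i : ℕ) : Type :=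
  (⨂[R]^i M) ⧸ Submodule.span R
    {z | ∃ (σ : Equiv.Perm (Fin i)) (f : Fin i → M),
      z = PiTensorProduct.tprod R f - PiTensorProduct.tprod R (f ∘ σ)}

section ExtPow

variable {R M N : Type} [CommRing R] [AddCommGroup M] [Module R M]
  [AddCommGroup N] [Module R N]

lemma extPow_map_mem (p : ℕ) (f : M →ₗ[R] N) {x : ExteriorAlgebra R M}
    (hx : x ∈ ⋀[R]^p M) : ExteriorAlgebra.map f x ∈ ⋀[R]^p N := by
  rw [← ExteriorAlgebra.ιMulti_span_fixedDegree] at hx ⊢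
  induction hx using Submodule.span_induction with
  | mem x h =>
      obtain ⟨v, rfl⟩ := h
      rw [ExteriorAlgebra.map_apply_ιMulti]
      exact Submodule.subset_span ⟨_, rfl⟩
  | zero => simpa using Submodule.zero_mem _
  | add x y _ _ h1 h2 => simpa using Submodule.add_mem _ h1 h2
  | smul r x _ h => simpa using Submodule.smul_mem _ r h

/-- The induced map `⋀^p M → ⋀^p N` of a linear map `f : M → N`. -/
def extPowMap (p : ℕ) (f : M →ₗ[R] N) : (⋀[R]^p M) →ₗ[R] (⋀[R]^p N) :=
  (ExteriorAlgebra.map f).toLinearMap.restrict (fun _ hx => extPow_map_mem p f hx)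

end ExtPow

section Wedge

variable (R L : Type) [CommRing R] [AddCommGroup L] [Module R L]

/-- Auxiliary map `L ⊗ L → Λ(L)`, `x ⊗ y ↦ ι x * ι y`. -/
def wedgeToAlg : L ⊗[R] L →ₗ[R] ExteriorAlgebra R L :=
  (LinearMap.mul' R (ExteriorAlgebra R L)).comp
    (TensorProduct.map (ExteriorAlgebra.ι R) (ExteriorAlgebra.ι R))

lemma wedgeToAlg_mem (z : L ⊗[R] L) : wedgeToAlg R L z ∈ ⋀[R]^2 L := by
  induction z using TensorProduct.induction_on with
  | zero => simpa using Submodule.zero_mem _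
  | tmul x y =>
      have : wedgeToAlg R L (x ⊗ₜ[R] y) =
          ExteriorAlgebra.ι R x * ExteriorAlgebra.ι R y := by
        simp [wedgeToAlg]
      have h2 : (⋀[R]^2 L) =
          LinearMap.range (ExteriorAlgebra.ι R (M := L)) *
            LinearMap.range (ExteriorAlgebra.ι R (M := L)) := pow_two _
      rw [this, h2]
      exact Submodule.mul_mem_mul (LinearMap.mem_range_self _ x) (LinearMap.mem_range_self _ y)
  | add x y h1 h2 => simpa using Submodule.add_mem _ h1 h2

/-- The wedge product map `L ⊗ L → ⋀² L`, `x ⊗ y ↦ x ∧ y`. -/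
def wedge2 : L ⊗[R] L →ₗ[R] (⋀[R]^2 L) :=
  (wedgeToAlg R L).codRestrict _ (wedgeToAlg_mem R L)

end Wedge

section ExtTor

variable (R : Type) [CommRing R]

/-- `Ext^i_R(M, N)` as an object of `ModuleCat R` (via the derived functor `Ext`). -/
abbrev ExtM (i : ℕ) (M N : Type) [AddCommGroup M] [Module R M] [AddCommGroup N] [Module R N] :
    ModuleCat R :=
  ((Ext R (ModuleCat R) i).obj (Opposite.op (ModuleCat.of R M))).obj (ModuleCat.of R N)

/-- `Tor_i^R(M, N)` as an object of `ModuleCat R` (via the derived functor `Tor`). -/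
abbrev TorM (i : ℕ) (M N : Type) [AddCommGroup M] [Module R M] [AddCommGroup N] [Module R N] :
    ModuleCat R :=
  ((Tor (ModuleCat R) i).obj (ModuleCat.of R M)).obj (ModuleCat.of R N)

/-- Isomorphism of `R`-modules, stated for objects of `ModuleCat R`. -/
def misoM {R : Type} [CommRing R] (X Y : ModuleCat R) : Prop := Nonempty (X ≅ Y)

end ExtTor

section Schur

/-- The cells of the Young diagram whose `r`-th row has length `lens r`. -/
abbrev YoungCells (m : ℕ) (lens : Fin m → ℕ) : Type := Σ r : Fin m, Fin (lens r)

variable (R M : Type) [CommRing R] [AddCommGroup M] [Module R M]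

/-- The action of a permutation of the index set on a tensor power. -/
def permAct {ι : Type} [Fintype ι] (σ : Equiv.Perm ι) :
    (⨂[R] _ : ι, M) →ₗ[R] (⨂[R] _ : ι, M) :=
  (PiTensorProduct.reindex R (fun _ : ι => M) σ).toLinearMap

open scoped Classical in
/-- The Young symmetrizer attached to the Young diagram with row lengths `lens`:
`e = Σ_{σ ∈ RowStab} Σ_{τ ∈ ColStab} sgn(τ) • (σ τ)` acting on the tensor power of `M`
indexed by the cells of the diagram.  (We work in characteristic zero, where its image
is the Schur power `Σ^I M` for the partition `I` with conjugate row lengths `lens`.) -/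
def youngSymmetrizer (m : ℕ) (lens : Fin m → ℕ) :
    (⨂[R] _ : YoungCells m lens, M) →ₗ[R] (⨂[R] _ : YoungCells m lens, M) :=
  ∑ σ : Equiv.Perm (YoungCells m lens), ∑ τ : Equiv.Perm (YoungCells m lens),
    if (∀ x, (σ x).1 = x.1) ∧ (∀ x, ((τ x).2 : ℕ) = ((x.2 : ℕ))) then
      ((Equiv.Perm.sign τ : ℤ) • permAct R M (σ * τ))
    else 0

/-- The Schur power `Σ^I M` of `M`, for the partition `I` whose Young diagram has
row lengths `lens` (read as a Young diagram; rows of the diagram of `I`). -/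
abbrev SchurPow (m : ℕ) (lens : Fin m → ℕ) : Type :=
  ↥(LinearMap.range (youngSymmetrizer R M m lens))

end Schur

section SymZ

variable {g t : ℕ} (A : Matrix (Fin g) (Fin t) (RR k n))

/-- Auxiliary: `SZ A 0 = Hom_R(M, R/I_t(A)) = S_{-1}M` and `SZ A (m+1) = S_m M`. -/
def SZ : ℕ → Type
  | 0 => Mdl A →ₗ[RR k n] (RR k n ⧸ minors A t)
  | (m + 1) => SymPow (RR k n) (Mdl A) m

instance : ∀ m, AddCommGroup (SZ A m)
  | 0 => inferInstanceAs (AddCommGroup (Mdl A →ₗ[RR k n] (RR k n ⧸ minors A t)))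
  | (m + 1) => inferInstanceAs (AddCommGroup (SymPow (RR k n) (Mdl A) m))

instance : ∀ m, Module (RR k n) (SZ A m)
  | 0 => inferInstanceAs (Module (RR k n) (Mdl A →ₗ[RR k n] (RR k n ⧸ minors A t)))
  | (m + 1) => inferInstanceAs (Module (RR k n) (SymPow (RR k n) (Mdl A) m))

/-- `S_i M` for `i ∈ ℤ`, `i ≥ -1`:  `SymZ A (-1) = Hom(M, B_t)` and `SymZ A i = S_i M`
for `i ≥ 0` (junk value `Hom(M, B_t)` for `i < -1`). -/
abbrev SymZ (i : ℤ) : Type := SZ A (i + 1).toNat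

end SymZ

section IdealTransform

variable {R : Type} [CommRing R] (J : Ideal R)
variable (N : Type) [AddCommGroup N] [Module R N]

/-- `Hom_R(Jᵛ, N)`. -/
abbrev homPow (ν : ℕ) : Type := ↥(J ^ ν) →ₗ[R] N

/-- Restriction `Hom(Jᵛ, N) → Hom(Jᵘ, N)` along `Jᵘ ⊆ Jᵛ` for `ν ≤ μ`. -/
def homPowMap (ν μ : ℕ) (h : ν ≤ μ) : homPow J N ν →ₗ[R] homPow J N μ :=
  LinearMap.lcomp R N (Submodule.inclusion (Ideal.pow_le_pow_right h))

/-- The ideal transform `D_J(N) = colim_ν Hom_R(Jᵛ, N)`.  By Deligne's formula this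
computes `H⁰_*(U, Ñ)` for `U` the complement of `V(J)`. -/
abbrev IdealTransform : Type := Module.DirectLimit (homPow J N) (homPowMap J N)

end IdealTransform

/-- A homogeneous ideal of `R = k[x₀,…,xₙ]`. -/
def IsHomogIdeal (I : Ideal (RR k n)) : Prop :=
  ∀ f ∈ I, ∀ d : ℕ, MvPolynomial.homogeneousComponent d f ∈ I

/-- The identity element of `V ⊗ V*` for the free module `V = R^m` (both `V` and its
dual realized as `Fin m → R`). -/
def idElem (R : Type) [CommRing R] (m : ℕ) : (Fin m → R) ⊗[R] (Fin m → R) :=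
  ∑ i : Fin m, (Pi.single i 1) ⊗ₜ[R] (Pi.single i 1)

end KMR

namespace KMR

/-- A chain complex of projectives with an augmentation making it exact is a projective
resolution. -/
def resolutionOfExact {C : Type*} [Category* C] [Abelian C] {X : C} (K : ChainComplex C ℕ)
    (hproj : ∀ i, Projective (K.X i)) (f : K.X 0 ⟶ X) (w : K.d 1 0 ≫ f = 0)
    (h₀ : (ShortComplex.mk _ _ w).Exact) (hf : Epi f) (h : ∀ i, K.ExactAt (i + 1)) :
    ProjectiveResolution X where
  complex := K
  projective := hproj
  π := (ChainComplex.toSingle₀Equiv _ _).symm ⟨f, w⟩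
  quasiIso := ⟨fun i => by
    match i with
    | 0 =>
      have e : ((ChainComplex.toSingle₀Equiv K X).symm ⟨f, w⟩).f 0 = f :=
        ChainComplex.toSingle₀Equiv_symm_apply_f_zero f w
      rw [ChainComplex.quasiIsoAt₀_iff, ShortComplex.quasiIso_iff_of_zeros' _ (by simp; rfl) rfl rfl]
      constructor
      · convert h₀ using 1
        congr 1
      · change Epi (((ChainComplex.toSingle₀Equiv K X).symm ⟨f, w⟩).f 0)
        rwa [e]
    | i + 1 =>
      rw [quasiIsoAt_iff_exactAt' _ _ (ChainComplex.exactAt_succ_single_obj _ _)]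
      exact h i⟩

section Resolution

variable {R : Type} [CommRing R] {X P₀ P₁ P₂ : Type}
  [AddCommGroup X] [Module R X] [AddCommGroup P₀] [Module R P₀] [AddCommGroup P₁] [Module R P₁]
  [AddCommGroup P₂] [Module R P₂]

/-- The terms of the chain complex `0 → P₂ → P₁ → P₀`. -/
def threeTermX (R : Type) [CommRing R] (P₀ P₁ P₂ : Type) [AddCommGroup P₀] [Module R P₀]
    [AddCommGroup P₁] [Module R P₁] [AddCommGroup P₂] [Module R P₂] : ℕ → ModuleCat.{0} R
  | 0 => ModuleCat.of R P₀
  | 1 => ModuleCat.of R P₁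
  | 2 => ModuleCat.of R P₂
  | _ + 3 => ModuleCat.of R PUnit

/-- The differentials of the chain complex `0 → P₂ → P₁ → P₀`. -/
def threeTermD (d₁ : P₁ →ₗ[R] P₀) (d₂ : P₂ →ₗ[R] P₁) :
    ∀ i, threeTermX R P₀ P₁ P₂ (i + 1) ⟶ threeTermX R P₀ P₁ P₂ i
  | 0 => ModuleCat.ofHom d₁
  | 1 => ModuleCat.ofHom d₂
  | 2 => ModuleCat.ofHom (0 : PUnit →ₗ[R] P₂)
  | _ + 3 => ModuleCat.ofHom (0 : PUnit →ₗ[R] PUnit)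

/-- The chain complex `0 → P₂ → P₁ → P₀`. -/
def threeTerm (d₁ : P₁ →ₗ[R] P₀) (d₂ : P₂ →ₗ[R] P₁) (h : d₁ ∘ₗ d₂ = 0) :
    ChainComplex (ModuleCat.{0} R) ℕ :=
  ChainComplex.of (threeTermX R P₀ P₁ P₂) (threeTermD d₁ d₂) fun i => by
    match i with
    | 0 => exact ModuleCat.hom_ext h
    | 1 => exact ModuleCat.hom_ext (LinearMap.comp_zero _)
    | 2 => exact ModuleCat.hom_ext (LinearMap.comp_zero _)
    | i + 3 => exact ModuleCat.hom_ext (LinearMap.comp_zero _)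

lemma threeTerm_d (d₁ : P₁ →ₗ[R] P₀) (d₂ : P₂ →ₗ[R] P₁) (h : d₁ ∘ₗ d₂ = 0) (i : ℕ) :
    (threeTerm d₁ d₂ h).d (i + 1) i = threeTermD d₁ d₂ i :=
  ChainComplex.of_d _ _ _

lemma threeTerm_exactAt_succ (d₁ : P₁ →ₗ[R] P₀) (d₂ : P₂ →ₗ[R] P₁) (h : Function.Exact d₂ d₁)
    (hd₂ : Function.Injective d₂) (i : ℕ) :
    (threeTerm d₁ d₂ h.linearMap_comp_eq_zero).ExactAt (i + 1) := by
  rw [HomologicalComplex.exactAt_iff' _ (i + 1 + 1) (i + 1) i (by simp) (by simp),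
    ShortComplex.moduleCat_exact_iff]
  intro x hx
  change (threeTerm d₁ d₂ h.linearMap_comp_eq_zero).d (i + 1) i x = 0 at hx
  change ∃ y, (threeTerm d₁ d₂ h.linearMap_comp_eq_zero).d (i + 1 + 1) (i + 1) y = x
  rw [threeTerm_d] at hx ⊢
  match i with
  | 0 => exact (h x).1 hx
  | 1 => exact ⟨PUnit.unit, (hd₂ (hx.trans (map_zero d₂).symm)).symm⟩
  | i + 2 => exact ⟨PUnit.unit, Subsingleton.elim (α := PUnit) _ _⟩

/-- The projective resolution `0 → P₂ → P₁ → P₀ → X → 0`. -/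
def threeTermResolution [Module.Projective R P₀] [Module.Projective R P₁] [Module.Projective R P₂]
    (ε : P₀ →ₗ[R] X) (d₁ : P₁ →ₗ[R] P₀) (d₂ : P₂ →ₗ[R] P₁)
    (hε : Function.Surjective ε) (h₁ : Function.Exact d₁ ε) (h₂ : Function.Exact d₂ d₁)
    (hd₂ : Function.Injective d₂) : ProjectiveResolution (ModuleCat.of R X) :=
  resolutionOfExact (threeTerm d₁ d₂ h₂.linearMap_comp_eq_zero)
    (fun i => match i with
      | 0 => inferInstanceAs (Projective (ModuleCat.of R P₀))
      | 1 => inferInstanceAs (Projective (ModuleCat.of R P₁))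
      | 2 => inferInstanceAs (Projective (ModuleCat.of R P₂))
      | _ + 3 => inferInstanceAs (Projective (ModuleCat.of R PUnit)))
    (ModuleCat.ofHom ε)
    (by rw [threeTerm_d]; exact ModuleCat.hom_ext h₁.linearMap_comp_eq_zero)
    ((ShortComplex.moduleCat_exact_iff _).2 fun x hx => by
      change ∃ y, (threeTerm d₁ d₂ h₂.linearMap_comp_eq_zero).d 1 0 y = x
      rw [threeTerm_d]
      exact (h₁ x).1 hx)
    ((ModuleCat.epi_iff_surjective _).2 hε) (threeTerm_exactAt_succ d₁ d₂ h₂ hd₂)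

/-- The homology of a short complex of modules which is isomorphic to `A → B → C`. -/
lemma nonempty_homology_equiv (S : ShortComplex (ModuleCat.{0} R)) {A B C : Type}
    [AddCommGroup A] [Module R A] [AddCommGroup B] [Module R B] [AddCommGroup C] [Module R C]
    (f : A →ₗ[R] B) (g : B →ₗ[R] C) (a : S.X₁ ≃ₗ[R] A) (b : S.X₂ ≃ₗ[R] B) (c : S.X₃ ≃ₗ[R] C)
    (hf : ∀ x, b (S.f x) = f (a x)) (hg : ∀ x, c (S.g x) = g (b x)) :
    Nonempty (S.homology ≅
      ModuleCat.of R (LinearMap.ker g ⧸ (LinearMap.range f).submoduleOf (LinearMap.ker g))) := by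
  refine ⟨S.moduleCatHomologyIso ≪≫ LinearEquiv.toModuleIso (Submodule.Quotient.equiv _ _
    (b.ofSubmodules _ _ ?_) ?_)⟩
  · ext y
    constructor
    · rintro ⟨x, hx, rfl⟩
      change g (b x) = 0
      rw [← hg, show S.g x = 0 from hx, map_zero]
    · intro hy
      refine ⟨b.symm y, c.injective ?_, b.apply_symm_apply y⟩
      change c (S.g (b.symm y)) = c 0
      rw [hg, b.apply_symm_apply, map_zero]
      exact hy
  · ext y
    constructor
    · rintro ⟨_, ⟨x, rfl⟩, rfl⟩
      exact ⟨a x, (hf x).symm⟩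
    · rintro ⟨x, hx⟩
      refine ⟨_, ⟨a.symm x, rfl⟩, Subtype.ext ?_⟩
      change b (S.f (a.symm x)) = y.1
      rw [hf, a.apply_symm_apply]
      exact hx

section Ext

variable (N : Type) [AddCommGroup N] [Module R N]
  [Module.Projective R P₀] [Module.Projective R P₁] [Module.Projective R P₂]
  (ε : P₀ →ₗ[R] X) (d₁ : P₁ →ₗ[R] P₀) (d₂ : P₂ →ₗ[R] P₁)
  (hε : Function.Surjective ε) (h₁ : Function.Exact d₁ ε) (h₂ : Function.Exact d₂ d₁)
  (hd₂ : Function.Injective d₂)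

include hε h₁ h₂ hd₂

lemma nonempty_ext_one_iso :
    Nonempty (((Ext R (ModuleCat R) 1).obj (Opposite.op (ModuleCat.of R X))).obj
        (ModuleCat.of R N) ≅
      ModuleCat.of R (LinearMap.ker (LinearMap.lcomp R N d₂) ⧸
        (LinearMap.range (LinearMap.lcomp R N d₁)).submoduleOf
          (LinearMap.ker (LinearMap.lcomp R N d₂)))) := by
  let P := threeTermResolution ε d₁ d₂ hε h₁ h₂ hd₂
  let K := P.complex.linearYonedaObj R (ModuleCat.of R N)
  obtain ⟨e⟩ := nonempty_homology_equiv (K.sc' 0 1 2) (LinearMap.lcomp R N d₁)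
    (LinearMap.lcomp R N d₂) ModuleCat.homLinearEquiv ModuleCat.homLinearEquiv
    ModuleCat.homLinearEquiv (fun x => congrArg (fun d => (d ≫ x).hom)
      (threeTerm_d d₁ d₂ h₂.linearMap_comp_eq_zero 0)) (fun x => congrArg (fun d => (d ≫ x).hom)
      (threeTerm_d d₁ d₂ h₂.linearMap_comp_eq_zero 1))
  exact ⟨P.isoExt 1 (ModuleCat.of R N) ≪≫
    ShortComplex.homologyMapIso (K.isoSc' 0 1 2 (by simp) (by simp)) ≪≫ e⟩

lemma nonempty_ext_two_iso :
    Nonempty (((Ext R (ModuleCat R) 2).obj (Opposite.op (ModuleCat.of R X))).obj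
        (ModuleCat.of R N) ≅
      ModuleCat.of R ((P₂ →ₗ[R] N) ⧸ LinearMap.range (LinearMap.lcomp R N d₂))) := by
  let P := threeTermResolution ε d₁ d₂ hε h₁ h₂ hd₂
  let K := P.complex.linearYonedaObj R (ModuleCat.of R N)
  obtain ⟨e⟩ := nonempty_homology_equiv (K.sc' 1 2 3) (LinearMap.lcomp R N d₂)
    (0 : (P₂ →ₗ[R] N) →ₗ[R] (PUnit →ₗ[R] N)) ModuleCat.homLinearEquiv ModuleCat.homLinearEquiv
    ModuleCat.homLinearEquiv (fun x => congrArg (fun d => (d ≫ x).hom)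
      (threeTerm_d d₁ d₂ h₂.linearMap_comp_eq_zero 1)) (fun x => 
      (congrArg (fun d => (d ≫ x).hom) (threeTerm_d d₁ d₂ h₂.linearMap_comp_eq_zero 2)).trans
        (LinearMap.comp_zero _))
  exact ⟨P.isoExt 2 (ModuleCat.of R N) ≪≫
    ShortComplex.homologyMapIso (K.isoSc' 1 2 3 (by simp) (by simp)) ≪≫ e ≪≫
    LinearEquiv.toModuleIso (Submodule.Quotient.equiv _ _
      ((LinearEquiv.ofEq _ _ LinearMap.ker_zero).trans Submodule.topEquiv) (by
        ext y
        constructor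
        · rintro ⟨x, hx, rfl⟩
          exact hx
        · intro hy
          exact ⟨⟨y, rfl⟩, hy, rfl⟩))⟩

end Ext

end Resolution

section ComplementaryMinors

variable {R : Type} [CommRing R] {ι κ : Type} [Fintype ι] [DecidableEq ι] [Fintype κ]
  [DecidableEq κ]

/-- The matrix `A` with two further columns `v` and `w`. -/
def borderedMatrix (A : Matrix κ ι R) (v w : κ → R) : Matrix κ (ι ⊕ Fin 2) R :=
  fromCols A (of fun i j => ![v i, w i] j)

/-- The determinant of the matrix `A` bordered by the unit vectors `p` and `q`, as a function of
`p` and `q`: up to sign, the maximal minor of `A` that omits the rows `p` and `q`. -/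
def complMinor (A : Matrix κ ι R) (e₀ : ι ⊕ Fin 2 ≃ κ) : Matrix κ κ R :=
  of fun p q => ((borderedMatrix A (Pi.single p 1) (Pi.single q 1)).submatrix e₀ id).det

variable (A : Matrix κ ι R) (e₀ : ι ⊕ Fin 2 ≃ κ)

lemma complMinor_mul : complMinor A e₀ * A = 0 := by
  ext p j
  let N : Matrix (ι ⊕ Fin 2) (ι ⊕ Fin 2) R :=
    (borderedMatrix A (Pi.single p 1) 0).submatrix e₀ id
  let β : (κ → R) →ₗ[R] R :=
    LinearMap.proj (Sum.inr 1) ∘ₗ cramer N ∘ₗ LinearMap.funLeft R R e₀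
  have hβ (w : κ → R) :
      β w = ((borderedMatrix A (Pi.single p 1) w).submatrix e₀ id).det := by
    simp only [β, LinearMap.comp_apply, LinearMap.proj_apply, cramer_apply]
    congr 1
    ext i (l | l)
    · simp [N, borderedMatrix]
    · fin_cases l <;> simp [N, borderedMatrix, LinearMap.funLeft_apply]
  have h : β (fun q => A q j) = 0 := by
    rw [hβ]
    refine det_zero_of_column_eq (i := Sum.inl j) (j := Sum.inr 1) (by simp) fun l => ?_
    simp [borderedMatrix]
  rw [LinearMap.pi_apply_eq_sum_univ] at h
  rw [mul_apply, Matrix.zero_apply, ← h]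
  refine Finset.sum_congr rfl fun q _ => ?_
  have : (fun j => if q = j then (1 : R) else 0) = Pi.single q 1 := by
    ext j; simp [Pi.single_apply, eq_comm]
  rw [this, hβ, smul_eq_mul, mul_comm]
  rfl

omit [Fintype κ] in
lemma complMinor_self (p : κ) : complMinor A e₀ p p = 0 :=
  det_zero_of_column_eq (i := Sum.inr 0) (j := Sum.inr 1) (by simp) fun l => by
    simp [borderedMatrix]

omit [Fintype κ] in
lemma transpose_complMinor : (complMinor A e₀)ᵀ = -complMinor A e₀ := by
  ext p q
  have h := det_permute' (Equiv.swap (Sum.inr 0) (Sum.inr 1) : Equiv.Perm (ι ⊕ Fin 2))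
    ((borderedMatrix A (Pi.single p 1) (Pi.single q 1)).submatrix e₀ id)
  rw [Equiv.Perm.sign_swap (by simp)] at h
  rw [Units.val_neg, Units.val_one, Int.cast_neg, Int.cast_one, neg_one_mul] at h
  refine Eq.trans (congrArg det ?_) h
  · ext i (l | l)
    · simp [borderedMatrix, Equiv.swap_apply_of_ne_of_ne]
    · fin_cases l <;> simp [borderedMatrix]

omit [Fintype κ] in
lemma exists_complMinor_eq (e : ι ⊕ Fin 2 ≃ κ) : ∃ u : R, u * u = 1 ∧
    complMinor A e₀ (e (Sum.inr 0)) (e (Sum.inr 1)) =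
      u * (A.submatrix (e ∘ Sum.inl) id).det := by
  set N := borderedMatrix A (Pi.single (e (Sum.inr 0)) 1) (Pi.single (e (Sum.inr 1)) 1) with hN
  have hblock : N.submatrix e id = fromBlocks (A.submatrix (e ∘ Sum.inl) id) 0
      (A.submatrix (e ∘ Sum.inr) id) 1 := by
    ext (i | i) (l | l)
    · simp [hN, borderedMatrix]
    · fin_cases l <;> simp [hN, borderedMatrix, Pi.single_apply]
    · simp [hN, borderedMatrix]
    · fin_cases l <;> fin_cases i <;> simp [hN, borderedMatrix, Pi.single_apply]
  have hdet := congrArg det hblock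
  rw [det_fromBlocks_zero₁₂, det_one, mul_one] at hdet
  have h := det_permute (e₀.trans e.symm) (N.submatrix e id)
  refine ⟨((Equiv.Perm.sign (e₀.trans e.symm) : ℤ) : R), ?_, ?_⟩
  · rw [← Int.cast_mul, Int.units_coe_mul_self, Int.cast_one]
  · rw [← hdet, ← h]
    simp only [complMinor, of_apply, ← hN, submatrix_submatrix]
    congr 2
    ext i
    simp

omit [DecidableEq κ] in
lemma exists_perm_apply_eq {α : Type} {f g : α → κ} (hf : Function.Injective f)
    (hg : Function.Injective g) : ∃ σ : Equiv.Perm κ, ∀ a, σ (f a) = g a := by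
  classical
  let e : {x // x ∈ Set.range f} ≃ {x // x ∈ Set.range g} :=
    (Equiv.ofInjective f hf).symm.trans (Equiv.ofInjective g hg)
  refine ⟨e.extendSubtype, fun a => ?_⟩
  rw [e.extendSubtype_apply_of_mem _ ⟨a, rfl⟩]
  have : (Equiv.ofInjective f hf).symm ⟨f a, a, rfl⟩ = a :=
    Equiv.ofInjective_symm_apply hf a
  simp only [e, Equiv.trans_apply, this, Equiv.ofInjective_apply]

omit [Fintype ι] [DecidableEq ι] [DecidableEq κ] in
include e₀ in
lemma exists_equiv_comp_inl_eq {r : ι → κ} (hr : Function.Injective r) :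
    ∃ e : ι ⊕ Fin 2 ≃ κ, e ∘ Sum.inl = r := by
  obtain ⟨σ, hσ⟩ := exists_perm_apply_eq (e₀.injective.comp Sum.inl_injective) hr
  exact ⟨e₀.trans σ, funext hσ⟩

omit [Fintype ι] [DecidableEq ι] [DecidableEq κ] in
include e₀ in
lemma exists_equiv_inr_eq {p q : κ} (hpq : p ≠ q) :
    ∃ e : ι ⊕ Fin 2 ≃ κ, e (Sum.inr 0) = p ∧ e (Sum.inr 1) = q := by
  obtain ⟨σ, hσ⟩ := exists_perm_apply_eq (e₀.injective.comp Sum.inr_injective)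
    (g := ![p, q]) (by
      intro i j hij
      fin_cases i <;> fin_cases j <;> simp_all [hpq.symm])
  exact ⟨e₀.trans σ, hσ 0, hσ 1⟩

end ComplementaryMinors

section MinorIdentities

variable {R : Type} [CommRing R] {ι κ : Type} [Fintype ι] [DecidableEq ι] [Fintype κ]
  [DecidableEq κ] {A : Matrix κ ι R} {e : ι ⊕ Fin 2 ≃ κ}

lemma exists_mul_eq_det_smul_one (A : Matrix κ ι R) (e : ι ⊕ Fin 2 ≃ κ) :
    ∃ P : Matrix ι κ R, P * A = (A.submatrix (e ∘ Sum.inl) id).det • (1 : Matrix ι ι R) ∧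
      ∀ i j, ((A.submatrix (e ∘ Sum.inl) id).det • (1 : Matrix κ κ R) - A * P)
        (e (Sum.inl i)) j = 0 := by
  set B := A.submatrix (e ∘ Sum.inl) id with hB
  have hS : (1 : Matrix κ κ R).submatrix (e ∘ Sum.inl) id * A = B := by
    rw [hB, ← Matrix.one_mul A, ← submatrix_mul_equiv _ _ _ (Equiv.refl κ)]
    simp
  refine ⟨adjugate B * (1 : Matrix κ κ R).submatrix (e ∘ Sum.inl) id, ?_, fun i j => ?_⟩
  · rw [Matrix.mul_assoc, hS, adjugate_mul]
  · have h : (A * (adjugate B * (1 : Matrix κ κ R).submatrix (e ∘ Sum.inl) id)) (e (Sum.inl i)) j =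
        (B * (adjugate B * (1 : Matrix κ κ R).submatrix (e ∘ Sum.inl) id)) i j := rfl
    rw [← Matrix.mul_assoc B, mul_adjugate] at h
    simp only [Matrix.sub_apply, h, Matrix.smul_mul, Matrix.one_mul]
    exact sub_self _

/-- The maximal minor of `A` selected by the rows `e ∘ Sum.inl`. -/
def minorAt (A : Matrix κ ι R) (e : ι ⊕ Fin 2 ≃ κ) : R := (A.submatrix (e ∘ Sum.inl) id).det

lemma minorAt_smul_eq_zero (S : Matrix ι ι R) (h : A * S = 0) : minorAt A e • S = 0 := by
  obtain ⟨P, hP, -⟩ := exists_mul_eq_det_smul_one A e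
  rw [← Matrix.one_mul S, ← Matrix.smul_mul, minorAt, ← hP, Matrix.mul_assoc, h, Matrix.mul_zero]

lemma exists_mul_symm_eq_minorAt_smul {X : Matrix κ ι R} (h : X * Aᵀ = A * Xᵀ) :
    ∃ S : Matrix ι ι R, Sᵀ = S ∧ A * S = minorAt A e ^ 2 • X := by
  obtain ⟨P, hP, -⟩ := exists_mul_eq_det_smul_one A e
  rw [← minorAt] at hP
  set Δ := minorAt A e
  have hP' : Aᵀ * Pᵀ = Δ • (1 : Matrix ι ι R) := by simpa using congrArg transpose hP
  have h₁ : A * (P * X)ᵀ = Δ • X := by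
    rw [transpose_mul, ← Matrix.mul_assoc, ← h, Matrix.mul_assoc, hP', Matrix.mul_smul,
      Matrix.mul_one]
  have h₂ : Δ • (P * X)ᵀ = Δ • (P * X) := by
    rw [← Matrix.mul_smul, ← h₁, ← Matrix.mul_assoc, hP, Matrix.smul_mul, Matrix.one_mul]
  exact ⟨Δ • (P * X)ᵀ, by rw [h₂, transpose_smul, h₂], by
    rw [Matrix.mul_smul, h₁, smul_smul, sq]⟩

lemma exists_skew_mul_eq_minorAt_smul {X : Matrix κ ι R} (h : Aᵀ * X + Xᵀ * A = 0) :
    ∃ Y : Matrix κ κ R, Yᵀ = -Y ∧ Y * A = minorAt A e ^ 2 • X := by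
  obtain ⟨P, hP, -⟩ := exists_mul_eq_det_smul_one A e
  rw [← minorAt] at hP
  set Δ := minorAt A e
  have h' : Aᵀ * X = -(Xᵀ * A) := eq_neg_of_add_eq_zero_left h
  have h'' : Pᵀ * (Aᵀ * (X * P)) = -(Pᵀ * (Xᵀ * (A * P))) := by
    rw [← Matrix.mul_assoc Aᵀ, h']; simp [Matrix.mul_assoc]
  refine ⟨Δ • (X * P - Pᵀ * Xᵀ) - Pᵀ * (Aᵀ * (X * P)), ?_, ?_⟩
  · simp only [transpose_sub, transpose_smul, transpose_mul, transpose_transpose, Matrix.mul_assoc]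
    linear_combination (norm := module) -h''
  · simp only [Matrix.sub_mul, Matrix.smul_mul, Matrix.mul_assoc, hP, Matrix.mul_smul,
      Matrix.mul_one, h', Matrix.mul_neg]
    module

variable [Invertible (2 : R)]

omit [Fintype κ] [DecidableEq κ] in
lemma eq_zero_of_transpose_eq_neg {Y : Matrix κ κ R} (hY : Yᵀ = -Y) (i : κ) : Y i i = 0 := by
  have : Y i i = - Y i i := congrFun (congrFun hY i) i
  have h2 : (2 : R) * Y i i = 0 := by linear_combination this
  simpa using congrArg (⅟(2 : R) * ·) h2

omit [DecidableEq ι] [DecidableEq κ] in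
/-- A skew-symmetric matrix that vanishes in the rows `e ∘ Sum.inl` has a single entry up to
sign. -/
lemma sum_mul_of_skew {D W : Matrix κ κ R} (hD : Dᵀ = -D) (hW : Wᵀ = -W) 
    (h : ∀ i j, W (e (Sum.inl i)) j = 0) :
    (Dᵀ * W).trace =
      2 * (D (e (Sum.inr 0)) (e (Sum.inr 1)) * W (e (Sum.inr 0)) (e (Sum.inr 1))) := by
  have hW' (i j) : W i j = - W j i := congrFun (congrFun hW j) i
  have hD' (i j) : D i j = - D j i := congrFun (congrFun hD j) i
  have h' (i j) : W j (e (Sum.inl i)) = 0 := by rw [hW', h, neg_zero]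
  simp only [trace, diag_apply, mul_apply, transpose_apply]
  rw [← e.sum_comp]
  simp_rw [← e.sum_comp (fun i => D i _ * W i _)]
  simp only [Fintype.sum_sum_type, h, h', mul_zero, Finset.sum_const_zero, Fin.sum_univ_two,
    zero_add, add_zero, eq_zero_of_transpose_eq_neg hW]
  rw [hW' (e (Sum.inr 1)), hD' (e (Sum.inr 1))]
  ring

lemma exists_eq_minorAt_smul {D Y : Matrix κ κ R} (hD : Dᵀ = -D) (hDA : D * A = 0) {u : R}
    (hu : u * u = 1) (hDe : D (e (Sum.inr 0)) (e (Sum.inr 1)) = u * minorAt A e)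
    (hY : Yᵀ = -Y) (h : (Dᵀ * Y).trace = 0) :
    ∃ X : Matrix κ ι R, X * Aᵀ - A * Xᵀ = minorAt A e ^ 3 • Y := by
  obtain ⟨P, hP, hrow⟩ := exists_mul_eq_det_smul_one A e
  rw [← minorAt] at hP hrow
  set Δ := minorAt A e
  set Q := Δ • (1 : Matrix κ κ R) - A * P with hQ
  have hDQ : D * Q = Δ • D := by
    rw [hQ, Matrix.mul_sub, ← Matrix.mul_assoc, hDA]; simp
  set W := Q * Y * Qᵀ with hW
  have hWt : Wᵀ = -W := by simp [hW, hY, Matrix.mul_assoc]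
  have hWrow (i j) : W (e (Sum.inl i)) j = 0 := by
    rw [hW, Matrix.mul_assoc, mul_apply]; simp [hrow]
  have htr : (Dᵀ * W).trace = 0 := by
    have h₁ : Dᵀ * Q = Δ • Dᵀ := by rw [hD]; simp [hDQ]
    have h₂ : Qᵀ * Dᵀ = Δ • Dᵀ := by rw [← transpose_mul, hDQ, transpose_smul]
    rw [hW, ← Matrix.mul_assoc, trace_mul_comm, ← Matrix.mul_assoc, ← Matrix.mul_assoc, h₂]
    simp [h₁, h]
  rw [sum_mul_of_skew hD hWt hWrow, hDe] at htr
  have hpq : Δ * W (e (Sum.inr 0)) (e (Sum.inr 1)) = 0 := by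
    linear_combination (⅟2 * u) * htr - (Δ * W (e (Sum.inr 0)) (e (Sum.inr 1))) * hu * (⅟2 * 2) -
      (Δ * W (e (Sum.inr 0)) (e (Sum.inr 1))) * invOf_mul_self (2 : R)
  have hW' (i j) : W i j = - W j i := congrFun (congrFun hWt j) i
  have hΔW : Δ • W = 0 := by
    ext i j
    obtain ⟨i, rfl⟩ := e.surjective i
    obtain ⟨j, rfl⟩ := e.surjective j
    rcases i with i | i
    · simp [hWrow]
    rcases j with j | j
    · rw [Matrix.smul_apply, hW', hWrow]; simp
    fin_cases i <;> fin_cases j <;>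
      simp [eq_zero_of_transpose_eq_neg hWt, hpq, hW' (e (Sum.inr 1)) (e (Sum.inr 0))]
  have hWexp : W = (Δ ^ 2) • Y - Δ • (A * P * Y + Y * Pᵀ * Aᵀ) + A * P * Y * Pᵀ * Aᵀ := by
    simp only [hW, hQ, transpose_sub, transpose_smul, transpose_one, transpose_mul, Matrix.mul_sub,
      Matrix.sub_mul, Matrix.smul_mul, Matrix.mul_smul, Matrix.one_mul, Matrix.mul_one,
      Matrix.mul_assoc]
    module
  refine ⟨Δ • (Δ • (Y * Pᵀ) - (⅟2 : R) • (A * P * Y * Pᵀ)), ?_⟩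
  rw [hWexp] at hΔW
  simp only [transpose_smul, transpose_sub, transpose_mul, transpose_transpose, hY, Matrix.mul_sub,
      Matrix.sub_mul, Matrix.smul_mul, Matrix.mul_smul, Matrix.neg_mul, Matrix.mul_neg,
      Matrix.mul_assoc] at hΔW ⊢
  have h2 : (⅟2 : R) • (A * (P * (Y * (Pᵀ * Aᵀ)))) + (⅟2 : R) • (A * (P * (Y * (Pᵀ * Aᵀ)))) =
      A * (P * (Y * (Pᵀ * Aᵀ))) := by
    rw [← add_smul, ← two_mul, mul_invOf_self, one_smul]
  linear_combination (norm := module) - hΔW - Δ • h2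

lemma exists_smul_eq_minorAt_smul {D Y : Matrix κ κ R} (hD : Dᵀ = -D) (hDA : D * A = 0) {u : R}
    (hu : u * u = 1) (hDe : D (e (Sum.inr 0)) (e (Sum.inr 1)) = u * minorAt A e)
    (hY : Yᵀ = -Y) (h : Y * A = 0) : ∃ r : R, r • D = minorAt A e ^ 3 • Y := by
  obtain ⟨P, hP, hrow⟩ := exists_mul_eq_det_smul_one A e
  rw [← minorAt] at hP hrow
  set Δ := minorAt A e
  set Q := Δ • (1 : Matrix κ κ R) - A * P with hQ
  set p := e (Sum.inr 0)
  set q := e (Sum.inr 1)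
  set V := D p q • Y - Y p q • D with hV
  have hVt : Vᵀ = -V := by simp [hV, hD, hY, sub_eq_add_neg, add_comm]
  have hV' (i j) : V i j = - V j i := congrFun (congrFun hVt j) i
  have hVpq : V p q = 0 := by simp [hV, mul_comm]
  have hVQ : V * Q = Δ • V := by
    have : V * A = 0 := by simp [hV, Matrix.sub_mul, hDA, h]
    rw [hQ, Matrix.mul_sub, ← Matrix.mul_assoc, this]; simp
  have hQV : Qᵀ * V = Δ • V := by
    have := congrArg transpose hVQ
    simpa [hVt] using this
  have hV0 : Qᵀ * V * Q = 0 := by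
    ext i j
    rw [Matrix.mul_assoc, mul_apply, ← e.sum_comp]
    simp only [mul_apply, transpose_apply]
    simp_rw [← e.sum_comp (fun i => V _ i * Q i _)]
    simp only [Fintype.sum_sum_type, hrow, zero_mul, mul_zero,
      Finset.sum_const_zero, Fin.sum_univ_two, zero_add]
    simp [p, q] at hVpq
    simp [eq_zero_of_transpose_eq_neg hVt, hVpq, hV' (e (Sum.inr 1)) (e (Sum.inr 0))]
  rw [hQV, Matrix.smul_mul, hVQ, hV, hDe] at hV0
  refine ⟨u * Δ ^ 2 * Y p q, ?_⟩
  have h1 : (u * u) • (Δ ^ 3 • Y) = Δ ^ 3 • Y := by rw [hu, one_smul]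
  linear_combination (norm := module) h1 - u • hV0

end MinorIdentities
section Acyclicity

variable {R : Type} [CommRing R]

/-- If some power of each generator of a finitely generated ideal `I` carries `w` into `B`, and
`B` contains every element that `I` carries into `B`, then `w ∈ B`. -/
lemma mem_of_pow_smul_mem {F : Type} [AddCommGroup F] [Module R F] {S : Set R}
    (hfg : (Ideal.span S).FG) (B : Submodule R F)
    (hsat : ∀ w, (∀ r ∈ Ideal.span S, r • w ∈ B) → w ∈ B) (w : F)
    (h : ∀ s ∈ S, ∃ m : ℕ, s ^ m • w ∈ B) : w ∈ B := by
  let T : Ideal R := B.comap (LinearMap.toSpanSingleton R F w)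
  have hT : Ideal.span S ≤ T.radical := Ideal.span_le.2 fun s hs => h s hs
  obtain ⟨m, hm⟩ := Ideal.exists_pow_le_of_le_radical_of_fg hT hfg
  have key : ∀ m : ℕ, (∀ r ∈ Ideal.span S ^ m, r • w ∈ B) → w ∈ B := by
    intro m
    induction m with
    | zero => intro h; simpa using h 1 (by simp)
    | succ m ih =>
      intro h
      refine ih fun r hr => hsat _ fun r' hr' => ?_
      rw [smul_smul, mul_comm]
      exact h _ (pow_succ (Ideal.span S) m ▸ Ideal.mul_mem_mul hr hr')
  exact key m fun r hr => hm hr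

/-- `z` is regular on `F ⧸ (x, y)F`, `y` is regular on `F ⧸ xF` and `x` is regular on `F`. -/
structure Regular₃ (x y z : R) (F : Type) [AddCommGroup F] [Module R F] : Prop where
  fst : ∀ u v : F, x • u = x • v → u = v
  snd : ∀ u v : F, y • v = x • u → ∃ w, v = x • w
  trd : ∀ u₁ u₂ v : F, z • v = x • u₁ + y • u₂ → ∃ w₁ w₂, v = x • w₁ + y • w₂

variable {x y z : R} {F₁ F₂ F₃ : Type} [AddCommGroup F₁] [Module R F₁] [AddCommGroup F₂]
  [Module R F₂] [AddCommGroup F₃] [Module R F₃]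

lemma Regular₃.of_isWeaklyRegular (h : RingTheory.Sequence.IsWeaklyRegular R [x, y, z]) :
    Regular₃ x y z R where
  fst u v huv := by
    have := h.regular_mod_prev 0 (by simp)
    rw [isSMulRegular_quotient_iff_mem_of_smul_mem] at this
    have := this (u - v) (by simpa [mul_sub, sub_eq_zero] using huv)
    simpa [sub_eq_zero] using this
  snd u v huv := by
    have := h.regular_mod_prev 1 (by simp)
    rw [isSMulRegular_quotient_iff_mem_of_smul_mem] at this
    have := this v (by
      simp only [List.take_succ_cons, List.take_zero, Ideal.ofList_singleton, smul_eq_mul,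
        Ideal.mul_top, List.getElem_cons_succ, List.getElem_cons_zero] at huv ⊢
      exact Ideal.mem_span_singleton'.2 ⟨u, by rw [huv, mul_comm]⟩)
    simp only [List.take_succ_cons, List.take_zero, Ideal.ofList_singleton, smul_eq_mul,
      Ideal.mul_top] at this
    obtain ⟨w, hw⟩ := Ideal.mem_span_singleton'.1 this
    exact ⟨w, by rw [← hw, smul_eq_mul, mul_comm]⟩
  trd u₁ u₂ v huv := by
    have := h.regular_mod_prev 2 (by simp)
    rw [isSMulRegular_quotient_iff_mem_of_smul_mem] at this
    have := this v (by
      simp only [List.take_succ_cons, List.take_zero, Ideal.ofList_cons, Ideal.ofList_nil, smul_eq_mul,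
        Ideal.mul_top, List.getElem_cons_succ, List.getElem_cons_zero, sup_bot_eq] at huv ⊢
      rw [← Ideal.span_insert]
      exact Ideal.mem_span_pair.2 ⟨u₁, u₂, by rw [huv, mul_comm, mul_comm u₂]⟩)
    simp only [List.take_succ_cons, List.take_zero, Ideal.ofList_cons, Ideal.ofList_nil, smul_eq_mul,
      Ideal.mul_top, sup_bot_eq] at this
    rw [← Ideal.span_insert] at this
    obtain ⟨w₁, w₂, hw⟩ := Ideal.mem_span_pair.1 this
    exact ⟨w₁, w₂, by rw [← hw, smul_eq_mul, smul_eq_mul, mul_comm, mul_comm w₂]⟩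

lemma Regular₃.pi (h : Regular₃ x y z F₁) (ι : Type) : Regular₃ x y z (ι → F₁) where
  fst u v huv := funext fun i => h.fst _ _ (congrFun huv i)
  snd u v huv := by
    choose w hw using fun i => h.snd (u i) (v i) (congrFun huv i)
    exact ⟨w, funext hw⟩
  trd u₁ u₂ v huv := by
    choose w₁ w₂ hw using fun i => h.trd (u₁ i) (u₂ i) (v i) (congrFun huv i)
    exact ⟨w₁, w₂, funext hw⟩

lemma Regular₃.of_leftInverse (h : Regular₃ x y z F₁) (i : F₂ →ₗ[R] F₁) (p : F₁ →ₗ[R] F₂)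
    (hp : Function.LeftInverse p i) : Regular₃ x y z F₂ where
  fst u v huv := hp.injective (h.fst _ _ (by rw [← map_smul, huv, map_smul]))
  snd u v huv := by
    obtain ⟨w, hw⟩ := h.snd (i u) (i v) (by rw [← map_smul, huv, map_smul])
    exact ⟨p w, by rw [← map_smul, ← hw, hp]⟩
  trd u₁ u₂ v huv := by
    obtain ⟨w₁, w₂, hw⟩ := h.trd (i u₁) (i u₂) (i v) (by rw [← map_smul, huv]; simp)
    exact ⟨p w₁, p w₂, by rw [← map_smul, ← map_smul, ← map_add, ← hw, hp]⟩

lemma mem_range_of_smul_mem_range (h₁ : Regular₃ x y z F₁) (h₂ : Regular₃ x y z F₂)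
    (d : F₂ →ₗ[R] F₁) (hd : Function.Injective d) (w : F₁)
    (hx : x • w ∈ LinearMap.range d) (hy : y • w ∈ LinearMap.range d) :
    w ∈ LinearMap.range d := by
  obtain ⟨b₁, hb₁⟩ := hx
  obtain ⟨b₂, hb₂⟩ := hy
  obtain ⟨b, rfl⟩ := h₂.snd b₂ b₁ (hd (by simp only [map_smul, hb₁, hb₂, smul_comm x y]))
  exact ⟨b, h₁.fst _ _ (by rw [← map_smul, hb₁])⟩

lemma mem_range_of_smul_mem_range_of_exact (h₁ : Regular₃ x y z F₁) (h₂ : Regular₃ x y z F₂)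
    (h₃ : Regular₃ x y z F₃) (d : F₂ →ₗ[R] F₁) (d' : F₃ →ₗ[R] F₂) (hd' : Function.Injective d')
    (hdd' : Function.Exact d' d) (w : F₁) (hx : x • w ∈ LinearMap.range d)
    (hy : y • w ∈ LinearMap.range d) (hz : z • w ∈ LinearMap.range d) :
    w ∈ LinearMap.range d := by
  obtain ⟨b₁, hb₁⟩ := hx
  obtain ⟨b₂, hb₂⟩ := hy
  obtain ⟨b₃, hb₃⟩ := hz
  obtain ⟨c₁₂, hc₁₂⟩ := (hdd' (x • b₂ - y • b₁)).1 (by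
    simp only [map_sub, map_smul, hb₁, hb₂, smul_comm x y, sub_self])
  obtain ⟨c₁₃, hc₁₃⟩ := (hdd' (x • b₃ - z • b₁)).1 (by
    simp only [map_sub, map_smul, hb₁, hb₃, smul_comm x z, sub_self])
  obtain ⟨c₂₃, hc₂₃⟩ := (hdd' (y • b₃ - z • b₂)).1 (by
    simp only [map_sub, map_smul, hb₂, hb₃, smul_comm y z, sub_self])
  have hc : z • c₁₂ = x • (-c₂₃) + y • c₁₃ := hd' (by
    simp only [map_add, map_smul, map_neg, hc₁₂, hc₁₃, hc₂₃]
    module)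
  obtain ⟨e, f, rfl⟩ := h₃.trd _ _ _ hc
  obtain ⟨g, hg⟩ := h₃.snd (c₂₃ + z • e) (c₁₃ - z • f) (by
    linear_combination (norm := module) (-1 : R) • hc)
  have hdd (u) : d (d' u) = 0 := hdd'.apply_apply_eq_zero u
  obtain ⟨b, hb⟩ := h₂.snd (b₂ - d' e) (b₁ + d' f) (by
    simp only [map_add, map_smul] at hc₁₂
    linear_combination (norm := module) hc₁₂)
  exact ⟨b, h₁.fst _ _ (by rw [← map_smul, ← hb, map_add, hdd, add_zero, hb₁])⟩

end Acyclicity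

section SymmetricMatrices

variable (ι R : Type) [CommRing R]

/-- The module of symmetric matrices. -/
def symmMatrix : Submodule R (Matrix ι ι R) where
  carrier := {S | Sᵀ = S}
  add_mem' h h' := by simp_all
  zero_mem' := by simp
  smul_mem' c S h := by simp_all

/-- The module of skew-symmetric matrices. -/
def skewMatrix : Submodule R (Matrix ι ι R) where
  carrier := {S | Sᵀ = -S}
  add_mem' h h' := by simp_all [add_comm]
  zero_mem' := by simp
  smul_mem' c S h := by simp_all

variable {ι R}

lemma mem_symmMatrix {S : Matrix ι ι R} : S ∈ symmMatrix ι R ↔ Sᵀ = S := Iff.rfl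

lemma mem_skewMatrix {S : Matrix ι ι R} : S ∈ skewMatrix ι R ↔ Sᵀ = -S := Iff.rfl

variable (ι R) [Invertible (2 : R)]

/-- The symmetric part of a square matrix. -/
def symmPart : Matrix ι ι R →ₗ[R] symmMatrix ι R :=
  ((⅟2 : R) • (LinearMap.id + (transposeLinearEquiv ι ι R R).toLinearMap)).codRestrict _ fun S => by
    simp [mem_symmMatrix, add_comm]

/-- The skew-symmetric part of a square matrix. -/
def skewPart : Matrix ι ι R →ₗ[R] skewMatrix ι R :=
  ((⅟2 : R) • (LinearMap.id - (transposeLinearEquiv ι ι R R).toLinearMap)).codRestrict _ fun S => by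
    simp [mem_skewMatrix]

variable {ι R}

lemma coe_symmPart (S : Matrix ι ι R) : (symmPart ι R S : Matrix ι ι R) = (⅟2 : R) • (S + Sᵀ) := rfl

lemma coe_skewPart (S : Matrix ι ι R) : (skewPart ι R S : Matrix ι ι R) = (⅟2 : R) • (S - Sᵀ) := rfl

lemma leftInverse_symmPart :
    Function.LeftInverse (symmPart ι R) (symmMatrix ι R).subtype := fun S => by
  ext1
  rw [coe_symmPart, Submodule.subtype_apply, mem_symmMatrix.1 S.2, ← two_smul R, smul_smul,
    invOf_mul_self, one_smul]

lemma leftInverse_skewPart :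
    Function.LeftInverse (skewPart ι R) (skewMatrix ι R).subtype := fun S => by
  ext1
  rw [coe_skewPart, Submodule.subtype_apply, mem_skewMatrix.1 S.2, sub_neg_eq_add, ← two_smul R,
    smul_smul, invOf_mul_self, one_smul]

instance [Finite ι] : Module.Projective R (symmMatrix ι R) :=
  .of_split (symmMatrix ι R).subtype (symmPart ι R) (LinearMap.ext leftInverse_symmPart)

instance [Finite ι] : Module.Projective R (skewMatrix ι R) :=
  .of_split (skewMatrix ι R).subtype (skewPart ι R) (LinearMap.ext leftInverse_skewPart)

variable {κ : Type} {x y z : R}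

omit [Invertible (2 : R)] in
lemma Regular₃.matrix (h : Regular₃ x y z R) : Regular₃ x y z (Matrix κ ι R) :=
  (h.pi ι).pi κ

lemma Regular₃.symmMatrix (h : Regular₃ x y z R) : Regular₃ x y z (symmMatrix ι R) :=
  h.matrix.of_leftInverse _ _ leftInverse_symmPart

lemma Regular₃.skewMatrix (h : Regular₃ x y z R) : Regular₃ x y z (skewMatrix ι R) :=
  h.matrix.of_leftInverse _ _ leftInverse_skewPart

end SymmetricMatrices

section Complexes

set_option linter.unusedSectionVars false

variable {R : Type} [CommRing R] {ι κ : Type} [Fintype ι] [DecidableEq ι] [Fintype κ]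
  [DecidableEq κ]

/-- The ideal generated by the maximal minors of `A`. -/
def minorIdeal (A : Matrix κ ι R) : Ideal R :=
  Ideal.span (Set.range fun e : ι ⊕ Fin 2 ≃ κ => minorAt A e)

/-- Left multiplication of symmetric matrices by `A`. -/
def symmMul (A : Matrix κ ι R) : symmMatrix ι R →ₗ[R] Matrix κ ι R :=
  mulLeftLinearMap ι R A ∘ₗ (symmMatrix ι R).subtype

/-- The map `X ↦ X Aᵀ - A Xᵀ`. -/
def skewMulTranspose (A : Matrix κ ι R) : Matrix κ ι R →ₗ[R] skewMatrix κ R :=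
  (mulRightLinearMap κ R Aᵀ -
    mulLeftLinearMap κ R A ∘ₗ (transposeLinearEquiv κ ι R R).toLinearMap).codRestrict _ fun X => by
      simp [mem_skewMatrix]

/-- The trace form with the matrix `D`, on skew-symmetric matrices. -/
def skewTrace (D : Matrix κ κ R) : skewMatrix κ R →ₗ[R] R :=
  traceLinearMap κ R R ∘ₗ mulLeftLinearMap κ R Dᵀ ∘ₗ (skewMatrix κ R).subtype

/-- Right multiplication of skew-symmetric matrices by `A`. -/
def skewMul (A : Matrix κ ι R) : skewMatrix κ R →ₗ[R] Matrix κ ι R :=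
  mulRightLinearMap κ R A ∘ₗ (skewMatrix κ R).subtype

/-- The map `X ↦ Aᵀ X + Xᵀ A`. -/
def symmTransposeMul (A : Matrix κ ι R) : Matrix κ ι R →ₗ[R] symmMatrix ι R :=
  (mulLeftLinearMap ι R Aᵀ +
    mulRightLinearMap ι R A ∘ₗ (transposeLinearEquiv κ ι R R).toLinearMap).codRestrict _ fun X => by
      simp [mem_symmMatrix, add_comm]

variable (A : Matrix κ ι R)

lemma symmMul_apply (S : symmMatrix ι R) : symmMul A S = A * (S : Matrix ι ι R) := rfl
lemma coe_skewMulTranspose (X : Matrix κ ι R) :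
    (skewMulTranspose A X : Matrix κ κ R) = X * Aᵀ - A * Xᵀ := rfl
lemma skewTrace_apply (D : Matrix κ κ R) (Y : skewMatrix κ R) :
    skewTrace D Y = (Dᵀ * (Y : Matrix κ κ R)).trace := rfl
lemma skewMul_apply (Y : skewMatrix κ R) : skewMul A Y = (Y : Matrix κ κ R) * A := rfl
lemma coe_symmTransposeMul (X : Matrix κ ι R) :
    (symmTransposeMul A X : Matrix ι ι R) = Aᵀ * X + Xᵀ * A := rfl

lemma symmMul_comp : skewMulTranspose A ∘ₗ symmMul A = 0 := by
  ext1 S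
  ext1
  simp [coe_skewMulTranspose, symmMul_apply, mem_symmMatrix.1 S.2, Matrix.mul_assoc]

lemma skewMulTranspose_comp {D : Matrix κ κ R} (hD : Dᵀ = -D) (hDA : D * A = 0) :
    skewTrace D ∘ₗ skewMulTranspose A = 0 := by
  ext1 X
  have h : Aᵀ * D = 0 := by
    simpa [hD] using congrArg transpose hDA
  simp only [LinearMap.comp_apply, skewTrace_apply, coe_skewMulTranspose, hD, LinearMap.zero_apply,
    Matrix.neg_mul, Matrix.mul_sub, ← Matrix.mul_assoc, hDA]
  rw [Matrix.zero_mul, neg_zero, sub_zero, trace_neg, trace_mul_comm, ← Matrix.mul_assoc, h]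
  simp

lemma skewMul_comp : symmTransposeMul A ∘ₗ skewMul A = 0 := by
  ext1 Y
  ext1
  simp [coe_symmTransposeMul, skewMul_apply, mem_skewMatrix.1 Y.2, Matrix.mul_assoc]

variable {A}

lemma mem_of_minorAt_pow_smul_mem {F : Type} [AddCommGroup F] [Module R F] (B : Submodule R F)
    (hsat : ∀ w, (∀ r ∈ minorIdeal A, r • w ∈ B) → w ∈ B) (w : F)
    (h : ∀ e : ι ⊕ Fin 2 ≃ κ, ∃ m : ℕ, minorAt A e ^ m • w ∈ B) : w ∈ B :=
  mem_of_pow_smul_mem (Submodule.fg_span (Set.finite_range _)) B hsat w (by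
    rintro _ ⟨e, rfl⟩
    exact h e)

variable [Invertible (2 : R)] {x y z : R} (hreg : Regular₃ x y z R) (hx : x ∈ minorIdeal A)
  (hy : y ∈ minorIdeal A) (hz : z ∈ minorIdeal A) (e₀ : ι ⊕ Fin 2 ≃ κ)

include hreg hx

lemma symmMul_injective : Function.Injective (symmMul A) := by
  rw [injective_iff_map_eq_zero]
  intro S hS
  rw [← Submodule.mem_bot R]
  refine mem_of_minorAt_pow_smul_mem (A := A) ⊥
    (fun w hw => hreg.symmMatrix.fst w 0
      (((Submodule.mem_bot R).1 (hw x hx)).trans (smul_zero x).symm)) S fun e => ⟨1, ?_⟩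
  rw [pow_one, Submodule.mem_bot]
  exact Subtype.ext (minorAt_smul_eq_zero (A := A) (e := e) S.1 hS)

lemma injective_toSpanSingleton :
    Function.Injective (LinearMap.toSpanSingleton R (skewMatrix κ R)
      ⟨complMinor A e₀, transpose_complMinor A e₀⟩) := by
  rw [injective_iff_map_eq_zero]
  intro r hr
  rw [← Submodule.mem_bot R]
  refine mem_of_minorAt_pow_smul_mem (A := A) ⊥
    (fun w hw => hreg.fst w 0
      (((Submodule.mem_bot R).1 (hw x hx)).trans (smul_zero x).symm)) r fun e => ⟨1, ?_⟩
  obtain ⟨u, hu, hDe⟩ := exists_complMinor_eq A e₀ e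
  have : r * complMinor A e₀ (e (Sum.inr 0)) (e (Sum.inr 1)) = 0 :=
    congrArg (fun Y : skewMatrix κ R => Y.1 (e (Sum.inr 0)) (e (Sum.inr 1))) hr
  rw [hDe, ← minorAt] at this
  rw [pow_one, Submodule.mem_bot, smul_eq_mul]
  linear_combination u * this - minorAt A e * r * hu

include hy

lemma exact_symmMul : Function.Exact (symmMul A) (skewMulTranspose A) := by
  refine LinearMap.exact_of_comp_eq_zero_of_ker_le_range (symmMul_comp A) fun X hX => ?_
  refine mem_of_minorAt_pow_smul_mem (A := A) _ (fun w hw => mem_range_of_smul_mem_range hreg.matrix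
    hreg.symmMatrix _ (symmMul_injective hreg hx) _ (hw x hx) (hw y hy)) X fun e => ⟨2, ?_⟩
  obtain ⟨S, hS, h⟩ := exists_mul_symm_eq_minorAt_smul (A := A) (e := e) (X := X)
    (sub_eq_zero.1 (congrArg Subtype.val hX))
  exact ⟨⟨S, hS⟩, h⟩

lemma exact_skewMul : Function.Exact (LinearMap.toSpanSingleton R (skewMatrix κ R)
      ⟨complMinor A e₀, transpose_complMinor A e₀⟩) (skewMul A) := by
  refine LinearMap.exact_of_comp_eq_zero_of_ker_le_range ?_ fun Y hY => ?_
  · ext1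
    simp [skewMul_apply, complMinor_mul]
  refine mem_of_minorAt_pow_smul_mem (A := A) _ (fun w hw => mem_range_of_smul_mem_range
    hreg.skewMatrix hreg _ (injective_toSpanSingleton hreg hx e₀) _ (hw x hx) (hw y hy)) Y
    fun e => ⟨3, ?_⟩
  obtain ⟨u, hu, hDe⟩ := exists_complMinor_eq A e₀ e
  obtain ⟨r, hr⟩ := exists_smul_eq_minorAt_smul (transpose_complMinor A e₀) (complMinor_mul A e₀)
    hu hDe Y.2 hY
  exact ⟨r, Subtype.ext hr⟩

include hz

lemma exact_skewMulTranspose :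
    Function.Exact (skewMulTranspose A) (skewTrace (complMinor A e₀)) := by
  have hD := transpose_complMinor A e₀
  refine LinearMap.exact_of_comp_eq_zero_of_ker_le_range
    (skewMulTranspose_comp A hD (complMinor_mul A e₀)) fun Y hY => ?_
  refine mem_of_minorAt_pow_smul_mem (A := A) _ (fun w hw => mem_range_of_smul_mem_range_of_exact
    hreg.skewMatrix hreg.matrix hreg.symmMatrix _ _ (symmMul_injective hreg hx)
    (exact_symmMul hreg hx hy) _ (hw x hx) (hw y hy) (hw z hz)) Y fun e => ⟨3, ?_⟩
  obtain ⟨u, hu, hDe⟩ := exists_complMinor_eq A e₀ e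
  obtain ⟨X, hX⟩ := exists_eq_minorAt_smul hD (complMinor_mul A e₀) hu hDe Y.2 hY
  exact ⟨X, Subtype.ext hX⟩

include e₀ in
lemma exact_symmTransposeMul : Function.Exact (skewMul A) (symmTransposeMul A) := by
  refine LinearMap.exact_of_comp_eq_zero_of_ker_le_range (skewMul_comp A) fun X hX => ?_
  refine mem_of_minorAt_pow_smul_mem (A := A) _ (fun w hw => mem_range_of_smul_mem_range_of_exact
    hreg.matrix hreg.skewMatrix hreg _ _ (injective_toSpanSingleton hreg hx e₀)
    (exact_skewMul hreg hx hy e₀) _ (hw x hx) (hw y hy) (hw z hz)) X fun e => ⟨2, ?_⟩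
  obtain ⟨Y, hY, h⟩ := exists_skew_mul_eq_minorAt_smul (A := A) (e := e) (X := X)
    (congrArg Subtype.val hX)
  exact ⟨⟨Y, hY⟩, h⟩

omit hreg hx hy hz

lemma range_skewTrace : LinearMap.range (skewTrace (complMinor A e₀)) = minorIdeal A := by
  have hD := transpose_complMinor A e₀
  apply le_antisymm
  · rintro _ ⟨Y, rfl⟩
    rw [skewTrace_apply, trace]
    refine Ideal.sum_mem _ fun i _ => ?_
    rw [diag_apply, mul_apply]
    refine Ideal.sum_mem _ fun j _ => Ideal.mul_mem_right _ _ ?_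
    rw [transpose_apply]
    by_cases hij : j = i
    · rw [hij, complMinor_self]
      exact Ideal.zero_mem _
    · obtain ⟨e, rfl, rfl⟩ := exists_equiv_inr_eq e₀ hij
      obtain ⟨u, -, h⟩ := exists_complMinor_eq A e₀ e
      rw [h]
      exact Ideal.mul_mem_left _ _ (Ideal.subset_span ⟨e, rfl⟩)
  · rw [minorIdeal, Ideal.span_le]
    rintro _ ⟨e, rfl⟩
    obtain ⟨u, hu, h⟩ := exists_complMinor_eq A e₀ e
    refine ⟨u • skewPart κ R (Matrix.single (e (Sum.inr 0)) (e (Sum.inr 1)) 1), ?_⟩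
    have h' := congrFun (congrFun hD (e (Sum.inr 0))) (e (Sum.inr 1))
    rw [transpose_apply, Matrix.neg_apply] at h'
    rw [map_smul, skewTrace_apply, coe_skewPart, transpose_single, Matrix.mul_smul, Matrix.mul_sub,
      trace_smul, trace_sub, trace_mul_single, trace_mul_single]
    simp only [transpose_apply, h', h, smul_eq_mul, MulOpposite.op_one, one_smul]
    rw [← minorAt]
    linear_combination minorAt A e * hu + (u * u) * minorAt A e * invOf_mul_self (2 : R)

end Complexes

section Duality

variable {R : Type} [CommRing R] {ι κ : Type} [Fintype ι] [DecidableEq ι] [Fintype κ]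
  [DecidableEq κ] {A : Matrix κ ι R} [Invertible (2 : R)]

lemma exists_comp_skewMulTranspose (hA : Function.Exact (skewMul A) (symmTransposeMul A))
    (f : Matrix κ ι R →ₗ[R] R) (hf : f ∘ₗ symmMul A = 0) :
    ∃ u : skewMatrix κ R →ₗ[R] R, f = u ∘ₗ skewMulTranspose A := by
  let Z : Matrix κ ι R := of fun i j => f (Matrix.single i j 1)
  have hZ (X : Matrix κ ι R) : f X = (Zᵀ * X).trace := by
    suffices f = traceLinearMap ι R R ∘ₗ mulLeftLinearMap ι R Zᵀ from
      congrArg (fun g : Matrix κ ι R →ₗ[R] R => g X) this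
    ext X
    conv_lhs => rw [matrix_eq_sum_single X]
    rw [Finset.sum_comm]
    simp only [map_sum, LinearMap.comp_apply, traceLinearMap_apply, mulLeftLinearMap_apply, trace,
      diag_apply, mul_apply, transpose_apply]
    refine Finset.sum_congr rfl fun j _ => Finset.sum_congr rfl fun i _ => ?_
    rw [← mul_one (X i j), ← smul_eq_mul, ← smul_single, map_smul]
    simp [Z, mul_comm]
  have hZA : symmTransposeMul A Z = 0 := by
    ext1
    rw [coe_symmTransposeMul]
    ext i j
    have hS : Matrix.single i j (1 : R) + Matrix.single j i 1 ∈ symmMatrix ι R := by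
      simp [mem_symmMatrix, add_comm]
    have h := congrArg (fun g : symmMatrix ι R →ₗ[R] R => g ⟨_, hS⟩) hf
    simp only [LinearMap.comp_apply, symmMul_apply, hZ, ← Matrix.mul_assoc, Matrix.mul_add,
      trace_add, trace_mul_single, LinearMap.zero_apply, MulOpposite.op_one, one_smul] at h
    have h' : (Aᵀ * Z) i j = (Zᵀ * A) j i := by
      rw [← transpose_apply (Zᵀ * A), transpose_mul, transpose_transpose]
    rw [Matrix.add_apply, h']
    simpa [add_comm] using h
  obtain ⟨Y, hY⟩ := (hA Z).1 hZA
  rw [skewMul_apply] at hY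
  refine ⟨(⅟2 : R) • skewTrace (Y : Matrix κ κ R), ?_⟩
  ext1 X
  have hYt : (Y : Matrix κ κ R)ᵀ = -Y := Y.2
  have h₁ : ((Y : Matrix κ κ R) * (A * Xᵀ)).trace = -((Y : Matrix κ κ R) * (X * Aᵀ)).trace := by
    rw [← trace_transpose]
    simp only [transpose_mul, transpose_transpose, hYt, Matrix.mul_neg, trace_neg]
    rw [trace_mul_comm]
  have h₂ : f X = -((Y : Matrix κ κ R) * (X * Aᵀ)).trace := by
    rw [hZ, ← hY, transpose_mul, hYt, Matrix.mul_assoc, trace_mul_comm]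
    simp [Matrix.mul_assoc]
  rw [h₂, LinearMap.comp_apply, LinearMap.smul_apply, skewTrace_apply, coe_skewMulTranspose, hYt,
    Matrix.neg_mul, Matrix.mul_sub, trace_neg, trace_sub, h₁, smul_eq_mul]
  linear_combination ((Y : Matrix κ κ R) * (X * Aᵀ)).trace * invOf_mul_self (2 : R)

lemma exists_apply_symmMul_eq (e₀ : ι ⊕ Fin 2 ≃ κ) (g : symmMatrix ι R →ₗ[R] minorIdeal A) :
    ∃ h : Matrix κ ι R →ₗ[R] R, ∀ S, h (symmMul A S) = g S := by
  have hP (p q : κ) : ∃ P : Matrix ι κ R, P * A = complMinor A e₀ p q • (1 : Matrix ι ι R) := by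
    by_cases hpq : p = q
    · exact ⟨0, by simp [hpq, complMinor_self]⟩
    · obtain ⟨e, rfl, rfl⟩ := exists_equiv_inr_eq e₀ hpq
      obtain ⟨u, -, h⟩ := exists_complMinor_eq A e₀ e
      obtain ⟨P, hP, -⟩ := exists_mul_eq_det_smul_one A e
      exact ⟨u • P, by rw [h, Matrix.smul_mul, hP, smul_smul]⟩
  choose P hP using hP
  let ε : skewMatrix κ R →ₗ[R] minorIdeal A := (skewTrace (complMinor A e₀)).codRestrict _ fun Y => by
    rw [← range_skewTrace e₀]
    exact ⟨Y, rfl⟩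
  have hε : Function.Surjective ε := by
    rintro ⟨r, hr⟩
    obtain ⟨Y, hY⟩ := (range_skewTrace (A := A) e₀).ge hr
    exact ⟨Y, Subtype.ext hY⟩
  obtain ⟨g', hg'⟩ := Module.projective_lifting_property ε g hε
  refine ⟨∑ p, ∑ q, entryLinearMap R R p q ∘ₗ (skewMatrix κ R).subtype ∘ₗ g' ∘ₗ symmPart ι R ∘ₗ
    mulLeftLinearMap ι R (P p q), fun S => ?_⟩
  have hS (p q) : symmPart ι R (P p q * symmMul A S) = complMinor A e₀ p q • S := by
    rw [symmMul_apply, ← Matrix.mul_assoc, hP, Matrix.smul_mul, Matrix.one_mul, map_smul]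
    exact congrArg _ (leftInverse_symmPart S)
  have hg : (g S : R) = skewTrace (complMinor A e₀) (g' S) := by rw [← hg']; rfl
  rw [hg, skewTrace_apply, trace]
  simp only [LinearMap.sum_apply, LinearMap.comp_apply, mulLeftLinearMap_apply, hS]
  rw [Finset.sum_comm]
  simp [mul_apply]

end Duality

section ConnectingIso

variable {R : Type} [CommRing R] {P₀ P₁ P₂ N : Type} [AddCommGroup P₀] [Module R P₀]
  [AddCommGroup P₁] [Module R P₁] [AddCommGroup P₂] [Module R P₂]
  [AddCommGroup N] [Module R N]

/-- If the dual of `P₂ → P₁ → P₀` is exact in the middle and every `P₂ → I` extends to `P₁ → R`,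
then the cohomology with coefficients in `N ≃ R ⧸ I` at `P₁` is that with coefficients in `I` at
`P₂`. -/
lemma nonempty_quotient_equiv [Module.Projective R P₀] [Module.Projective R P₁] (I : Ideal R)
    (π : R →ₗ[R] N) (hπ : Function.Surjective π) (hπI : ∀ r, π r = 0 ↔ r ∈ I)
    (d₁ : P₁ →ₗ[R] P₀) (d₂ : P₂ →ₗ[R] P₁) (hd : d₁ ∘ₗ d₂ = 0)
    (h₁ : ∀ f : P₁ →ₗ[R] R, f ∘ₗ d₂ = 0 → ∃ u : P₀ →ₗ[R] R, f = u ∘ₗ d₁)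
    (h₂ : ∀ g : P₂ →ₗ[R] I, ∃ h : P₁ →ₗ[R] R, ∀ s, h (d₂ s) = g s) :
    Nonempty ((LinearMap.ker (LinearMap.lcomp R (N) d₂) ⧸
        (LinearMap.range (LinearMap.lcomp R (N) d₁)).submoduleOf
          (LinearMap.ker (LinearMap.lcomp R (N) d₂))) ≃ₗ[R]
      (P₂ →ₗ[R] I) ⧸ LinearMap.range (LinearMap.lcomp R I d₂)) := by
  let Z : Submodule R (P₁ →ₗ[R] R) :=
    { carrier := {h | ∀ s, h (d₂ s) ∈ I}
      add_mem' := fun h h' s => I.add_mem (h s) (h' s)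
      zero_mem' := fun s => I.zero_mem
      smul_mem' := fun c h hh s => I.mul_mem_left c (hh s) }
  let α' : Z →ₗ[R] LinearMap.ker (LinearMap.lcomp R (N) d₂) :=
    ((LinearMap.compRight R π) ∘ₗ Z.subtype).codRestrict _ fun h => by
      ext s
      exact (hπI _).2 (h.2 s)
  let α := ((LinearMap.range (LinearMap.lcomp R (N) d₁)).submoduleOf
    (LinearMap.ker (LinearMap.lcomp R (N) d₂))).mkQ ∘ₗ α'
  let β' : Z →ₗ[R] P₂ →ₗ[R] I :=
    { toFun := fun h => (h.1 ∘ₗ d₂).codRestrict I h.2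
      map_add' := fun h h' => rfl
      map_smul' := fun c h => rfl }
  let β := (LinearMap.range (LinearMap.lcomp R I d₂)).mkQ ∘ₗ β'
  have hα : Function.Surjective α := (Submodule.mkQ_surjective _).comp fun ⟨f, hf⟩ => by
    obtain ⟨h, rfl⟩ := Module.projective_lifting_property π f hπ
    exact ⟨⟨h, fun s => (hπI _).1
      (congrArg (fun f : P₂ →ₗ[R] N => f s) hf)⟩, rfl⟩
  have hβ : Function.Surjective β := (Submodule.mkQ_surjective _).comp fun g => by
    obtain ⟨h, hh⟩ := h₂ g
    exact ⟨⟨h, fun s => hh s ▸ (g s).2⟩, LinearMap.ext fun s => Subtype.ext (hh s)⟩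
  have kerα (h : Z) : h ∈ LinearMap.ker α ↔ ∃ u : P₀ →ₗ[R] R, ∀ w, h.1 w - u (d₁ w) ∈ I := by
    refine (Submodule.Quotient.mk_eq_zero _ (x := α' h)).trans ?_
    constructor
    · rintro ⟨v, hv⟩
      obtain ⟨u, rfl⟩ := Module.projective_lifting_property π v hπ
      refine ⟨u, fun w => (hπI _).1 ?_⟩
      rw [map_sub, sub_eq_zero]
      exact (congrArg (fun f : P₁ →ₗ[R] N => f w) hv).symm
    · rintro ⟨u, hu⟩
      exact ⟨π ∘ₗ u, LinearMap.ext fun w => (sub_eq_zero.1 <|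
        (map_sub π _ _).symm.trans ((hπI _).2 (hu w))).symm⟩
  have kerβ (h : Z) : h ∈ LinearMap.ker β ↔ ∃ u : P₀ →ₗ[R] R, ∀ w, h.1 w - u (d₁ w) ∈ I := by
    refine (Submodule.Quotient.mk_eq_zero _ (x := β' h)).trans ?_
    constructor
    · rintro ⟨v, hv⟩
      obtain ⟨u, hu⟩ := h₁ (h.1 - I.subtype ∘ₗ v) (LinearMap.ext fun s => sub_eq_zero.2
        (congrArg (fun f : P₂ →ₗ[R] I => (f s : R)) hv).symm)
      refine ⟨u, fun w => ?_⟩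
      have : h.1 w - v w = u (d₁ w) := congrArg (fun f : P₁ →ₗ[R] R => f w) hu
      rw [← this, sub_sub_cancel]
      exact (v w).2
    · rintro ⟨u, hu⟩
      refine ⟨(h.1 - u ∘ₗ d₁).codRestrict I hu, LinearMap.ext fun s => Subtype.ext ?_⟩
      have : d₁ (d₂ s) = 0 := congrArg (fun f : P₂ →ₗ[R] P₀ => f s) hd
      change h.1 (d₂ s) - u (d₁ (d₂ s)) = h.1 (d₂ s)
      rw [this, map_zero, sub_zero]
  exact ⟨(α.quotKerEquivOfSurjective hα).symm.trans ((Submodule.quotEquivOfEq _ _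
    (Submodule.ext fun h => (kerα h).trans (kerβ h).symm)).trans
      (β.quotKerEquivOfSurjective hβ))⟩

end ConnectingIso

section SymmetricSquare

variable {R M L : Type} [CommRing R] [AddCommGroup M] [Module R M] [AddCommGroup L] [Module R L]

/-- A bilinear map as a multilinear map in two variables. -/
def multilinearOfBilin (C : M →ₗ[R] M →ₗ[R] L) : MultilinearMap R (fun _ : Fin 2 => M) L where
  toFun v := C (v 0) (v 1)
  map_update_add' v i x y := by fin_cases i <;> simp
  map_update_smul' v i c x := by fin_cases i <;> simp

/-- The linear map on the symmetric square induced by a symmetric bilinear map. -/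
def symSqLift (C : M →ₗ[R] M →ₗ[R] L) (hC : ∀ m m', C m m' = C m' m) : SymPow R M 2 →ₗ[R] L :=
  Submodule.liftQ _ (PiTensorProduct.lift (multilinearOfBilin C)) (by
    rw [Submodule.span_le]
    rintro _ ⟨σ, f, rfl⟩
    rw [SetLike.mem_coe, LinearMap.mem_ker, map_sub, PiTensorProduct.lift.tprod,
      PiTensorProduct.lift.tprod, sub_eq_zero]
    have h01 : σ 0 ≠ σ 1 := by simp
    change C (f 0) (f 1) = C (f (σ 0)) (f (σ 1))
    match h0 : σ 0, h1 : σ 1 with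
    | 0, 0 => simp [h0, h1] at h01
    | 0, 1 => rfl
    | 1, 0 => exact hC _ _
    | 1, 1 => simp [h0, h1] at h01)

variable (R) in
/-- The product of two elements in the symmetric square. -/
def symSqMk (m m' : M) : SymPow R M 2 := Submodule.Quotient.mk (PiTensorProduct.tprod R ![m, m'])

lemma symSqLift_mk (C : M →ₗ[R] M →ₗ[R] L) (hC : ∀ m m', C m m' = C m' m) (m m' : M) :
    symSqLift C hC (symSqMk R m m') = C m m' :=
  PiTensorProduct.lift.tprod _

lemma symSqMk_comm (m m' : M) : symSqMk R m m' = symSqMk R m' m := by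
  refine (Submodule.Quotient.eq _).2 (Submodule.subset_span ⟨Equiv.swap 0 1, ![m, m'], ?_⟩)
  congr 2
  ext i
  fin_cases i <;> simp

lemma symSqMk_add (m m₁ m₂ : M) :
    symSqMk R m (m₁ + m₂) = symSqMk R m m₁ + symSqMk R m m₂ := by
  have h (x : M) : Function.update ![m, 0] (1 : Fin 2) x = ![m, x] := by
    ext i
    fin_cases i <;> simp
  have := (PiTensorProduct.tprod R).map_update_add ![m, 0] 1 m₁ m₂
  simp only [h] at this
  exact congrArg _ this

lemma symSqMk_smul (c : R) (m m' : M) : symSqMk R m (c • m') = c • symSqMk R m m' := by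
  have h (x : M) : Function.update ![m, 0] (1 : Fin 2) x = ![m, x] := by
    ext i
    fin_cases i <;> simp
  have := (PiTensorProduct.tprod R).map_update_smul ![m, 0] 1 c m'
  simp only [h] at this
  exact congrArg _ this

variable (R M) in
/-- The product map to the symmetric square. -/
def symSqMul : M →ₗ[R] M →ₗ[R] SymPow R M 2 :=
  LinearMap.mk₂ R (symSqMk R)
    (fun m₁ m₂ m => by rw [symSqMk_comm, symSqMk_add, symSqMk_comm m, symSqMk_comm m])
    (fun _ _ _ => by rw [symSqMk_comm, symSqMk_smul, symSqMk_comm]) symSqMk_add symSqMk_smul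

lemma symSqMul_comm (m m' : M) : symSqMul R M m m' = symSqMul R M m' m := symSqMk_comm m m'

lemma symSqLift_mul (C : M →ₗ[R] M →ₗ[R] L) (hC : ∀ m m', C m m' = C m' m) (m m' : M) :
    symSqLift C hC (symSqMul R M m m') = C m m' :=
  symSqLift_mk C hC m m'

lemma symSq_induction {p : SymPow R M 2 → Prop} (s : SymPow R M 2)
    (mul : ∀ m m', p (symSqMul R M m m')) (add : ∀ s s', p s → p s' → p (s + s')) : p s := by
  obtain ⟨x, rfl⟩ := Submodule.Quotient.mk_surjective _ s
  induction x using PiTensorProduct.induction_on with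
  | smul_tprod c f =>
    have : (Submodule.Quotient.mk (c • PiTensorProduct.tprod R f) : SymPow R M 2) =
        symSqMul R M (f 0) (c • f 1) := by
      rw [map_smul]
      change _ = c • symSqMk R (f 0) (f 1)
      rw [symSqMk, Submodule.Quotient.mk_smul]
      congr 3
      ext i
      fin_cases i <;> rfl
    rw [this]
    exact mul _ _
  | add x y hx hy => exact add _ _ hx hy

end SymmetricSquare

section SymmetricSquareOfCokernel

set_option linter.unusedSectionVars false

lemma exists_bilin_quotient {R V L : Type} [CommRing R] [AddCommGroup V] [Module R V]
    [AddCommGroup L] [Module R L] (K : Submodule R V) (C : V →ₗ[R] V →ₗ[R] L)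
    (hC : ∀ v v', C v v' = C v' v) (hK : ∀ v ∈ K, C v = 0) :
    ∃ D : (V ⧸ K) →ₗ[R] (V ⧸ K) →ₗ[R] L, ∀ v v', D (K.mkQ v) (K.mkQ v') = C v v' := by
  have h₁ : K ≤ LinearMap.ker C := fun v hv => LinearMap.mem_ker.2 (hK v hv)
  have h₂ : K ≤ LinearMap.ker (K.liftQ C h₁).flip := by
    intro v hv
    refine LinearMap.mem_ker.2 (LinearMap.ext fun m => ?_)
    obtain ⟨v', rfl⟩ := K.mkQ_surjective m
    rw [LinearMap.flip_apply, Submodule.mkQ_apply, Submodule.liftQ_apply, hC, hK v hv,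
      LinearMap.zero_apply, LinearMap.zero_apply]
  refine ⟨(K.liftQ _ h₂).flip, fun v v' => ?_⟩
  rw [LinearMap.flip_apply, Submodule.mkQ_apply, Submodule.liftQ_apply, LinearMap.flip_apply,
    Submodule.mkQ_apply, Submodule.liftQ_apply]

variable {R : Type} [CommRing R] {ι κ : Type} [Fintype ι] [DecidableEq ι] [Fintype κ]
  [DecidableEq κ] (A : Matrix κ ι R) (N : Type) [AddCommGroup N] [Module R N]

/-- The cokernel of the restriction map along `symmMul A`. -/
abbrev SymmMulCoker : Type :=
  (symmMatrix ι R →ₗ[R] N) ⧸ LinearMap.range (LinearMap.lcomp R N (symmMul A))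

variable (R κ) in
/-- The linear form `X ↦ v ⬝ᵥ X *ᵥ f` on matrices. -/
def matrixForm : (κ → R) →ₗ[R] (ι → R) →ₗ[R] Matrix κ ι R →ₗ[R] R :=
  LinearMap.mk₂ R (fun v f =>
      { toFun := fun X => v ⬝ᵥ X *ᵥ f
        map_add' := fun X Y => by rw [Matrix.add_mulVec, dotProduct_add]
        map_smul' := fun c X => by rw [Matrix.smul_mulVec, dotProduct_smul, RingHom.id_apply] })
    (fun v v' f => by ext1 X; simp [add_dotProduct])
    (fun c v f => by ext1 X; simp [smul_dotProduct])
    (fun v f f' => by ext1 X; simp [Matrix.mulVec_add, dotProduct_add])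
    (fun c v f => by ext1 X; simp [Matrix.mulVec_smul, dotProduct_smul])

lemma matrixForm_apply (v : κ → R) (f : ι → R) (X : Matrix κ ι R) :
    matrixForm R κ v f X = v ⬝ᵥ X *ᵥ f := rfl

/-- The class of `S ↦ (f ⬝ᵥ S *ᵥ f') • n`. -/
def formClass : (ι → R) →ₗ[R] (ι → R) →ₗ[R] N →ₗ[R] SymmMulCoker A N :=
  ((matrixForm R ι).compr₂ (LinearMap.lcomp R R (symmMatrix ι R).subtype)).compr₂
    (LinearMap.smulRightₗ.compr₂ (Submodule.mkQ _))

lemma formClass_apply (f f' : ι → R) (n : N) : formClass A N f f' n = Submodule.Quotient.mk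
    ((matrixForm R ι f f' ∘ₗ (symmMatrix ι R).subtype).smulRight n) := rfl

lemma formClass_comm (f f' : ι → R) : formClass A N f f' = formClass A N f' f := by
  ext1 n
  rw [formClass_apply, formClass_apply]
  congr 2
  ext1 S
  have hS : (S : Matrix ι ι R)ᵀ = S := S.2
  simp only [LinearMap.comp_apply, matrixForm_apply, Submodule.subtype_apply]
  rw [dotProduct_mulVec, ← mulVec_transpose, hS, dotProduct_comm]

lemma formClass_mulVec (v : κ → R) : formClass A N (Aᵀ *ᵥ v) = 0 := by
  refine LinearMap.ext fun f => LinearMap.ext fun n => ?_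
  rw [formClass_apply]
  refine (Submodule.Quotient.mk_eq_zero _).2 ⟨(matrixForm R κ v f).smulRight n, ?_⟩
  ext1 S
  simp only [LinearMap.lcomp_apply, LinearMap.smulRight_apply, LinearMap.comp_apply,
    matrixForm_apply, symmMul_apply, Submodule.subtype_apply]
  rw [mulVec_transpose, ← dotProduct_mulVec, mulVec_mulVec]

variable {A N} {K : Submodule R (ι → R)} (hK : K = LinearMap.range (Aᵀ).mulVecLin)

variable (A N) in
include hK in
/-- The bilinear map on `coker Aᵀ` induced by `formClass`. -/
lemma exists_formClass_quotient : ∃ C : ((ι → R) ⧸ K) →ₗ[R] ((ι → R) ⧸ K) →ₗ[R] N →ₗ[R]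
    SymmMulCoker A N, ∀ f f', C (K.mkQ f) (K.mkQ f') = formClass A N f f' := by
  refine exists_bilin_quotient K _ (formClass_comm A N) fun f hf => ?_
  rw [hK] at hf
  obtain ⟨v, rfl⟩ := hf
  exact formClass_mulVec A N v

variable (K N) in
/-- The element of `S₂ ((ι → R) ⧸ K) ⊗ N` with coordinates `Z`. -/
def symSqCoord : (ι → ι → N) →ₗ[R] SymPow R ((ι → R) ⧸ K) 2 ⊗[R] N :=
  ∑ i, ∑ j, TensorProduct.mk R _ N
    (symSqMul R _ (K.mkQ (Pi.single i 1)) (K.mkQ (Pi.single j 1))) ∘ₗ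
      LinearMap.proj j ∘ₗ LinearMap.proj i

lemma symSqCoord_apply (Z : ι → ι → N) : symSqCoord N K Z = ∑ i, ∑ j,
    symSqMul R _ (K.mkQ (Pi.single i 1)) (K.mkQ (Pi.single j 1)) ⊗ₜ[R] Z i j := by
  simp [symSqCoord]

lemma symSqCoord_smul (f f' : ι → R) (n : N) : symSqCoord N K (fun i j => (f i * f' j) • n) =
    symSqMul R _ (K.mkQ f) (K.mkQ f') ⊗ₜ[R] n := by
  have h (g : ι → R) : K.mkQ g = ∑ i, g i • K.mkQ (Pi.single i 1) := by
    conv_lhs => rw [LinearMap.pi_apply_eq_sum_univ K.mkQ g]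
    refine Finset.sum_congr rfl fun i _ => ?_
    congr 2
    ext j
    simp [Pi.single_apply, eq_comm]
  rw [symSqCoord_apply, h f, h f']
  simp only [map_sum, LinearMap.sum_apply, TensorProduct.sum_tmul, map_smul, LinearMap.smul_apply,
    TensorProduct.tmul_smul, TensorProduct.smul_tmul', smul_smul, Finset.smul_sum]
  rw [Finset.sum_comm]
  simp only [mul_comm]

lemma symSqCoord_surjective : Function.Surjective (symSqCoord N K) := by
  intro s
  rw [← Set.mem_range, ← LinearMap.coe_range, SetLike.mem_coe]
  induction s using TensorProduct.induction_on with
  | zero => exact zero_mem _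
  | add s s' h h' => exact add_mem h h'
  | tmul s n =>
    induction s using symSq_induction with
    | add s s' h h' =>
      rw [TensorProduct.add_tmul]
      exact add_mem h h'
    | mul m m' =>
      obtain ⟨f, rfl⟩ := K.mkQ_surjective m
      obtain ⟨f', rfl⟩ := K.mkQ_surjective m'
      exact ⟨_, symSqCoord_smul f f' n⟩

lemma symSqCoord_transpose (Z : ι → ι → N) :
    symSqCoord N K (fun i j => Z j i) = symSqCoord N K Z := by
  rw [symSqCoord_apply, symSqCoord_apply, Finset.sum_comm]
  simp only [symSqMul_comm]

include hK in
lemma symSqCoord_mulVec (V : κ → ι → N) :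
    symSqCoord N K (fun i j => ∑ k, A k i • V k j) = 0 := by
  have h (k : κ) : K.mkQ (A k) = 0 := by
    rw [Submodule.mkQ_apply, Submodule.Quotient.mk_eq_zero, hK]
    exact ⟨Pi.single k 1, by rw [mulVecLin_apply, mulVec_single_one]; rfl⟩
  have hU : (fun i j => ∑ k, A k i • V k j) =
      ∑ k, ∑ l, fun i j => (A k i * (Pi.single l 1 : ι → R) j) • V k l := by
    ext i j
    simp [Finset.sum_apply, Pi.single_apply]
  rw [hU]
  simp only [map_sum]
  refine Finset.sum_eq_zero fun k _ => Finset.sum_eq_zero fun l _ => ?_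
  rw [symSqCoord_smul (A k), h, map_zero, LinearMap.zero_apply, TensorProduct.zero_tmul]

/-- The linear map `S ↦ ∑ S i j • Z i j`. -/
def symmPairing (Z : ι → ι → N) : symmMatrix ι R →ₗ[R] N :=
  ∑ i, ∑ j, (matrixForm R ι (Pi.single i 1) (Pi.single j 1) ∘ₗ
    (symmMatrix ι R).subtype).smulRight (Z i j)

lemma symmPairing_apply (Z : ι → ι → N) (S : symmMatrix ι R) :
    symmPairing Z S = ∑ i, ∑ j, (S : Matrix ι ι R) i j • Z i j := by
  simp [symmPairing, matrixForm_apply]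

lemma symmPairing_surjective [Invertible (2 : R)] :
    Function.Surjective (symmPairing : (ι → ι → N) → symmMatrix ι R →ₗ[R] N) := by
  intro g
  refine ⟨fun i j => g (symmPart ι R (single i j 1)), LinearMap.ext fun S => ?_⟩
  have hS : S = symmPart ι R (∑ i, ∑ j, single i j ((S : Matrix ι ι R) i j)) := by
    rw [← matrix_eq_sum_single]
    exact (leftInverse_symmPart S).symm
  conv_rhs => rw [hS]
  simp only [symmPairing_apply, map_sum]
  refine Finset.sum_congr rfl fun i _ => Finset.sum_congr rfl fun j _ => ?_
  rw [← map_smul, ← map_smul, smul_single, smul_eq_mul, mul_one]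

lemma symmPairing_single (Z : ι → ι → N) (i j : ι)
    (h : single i j 1 + single j i 1 ∈ symmMatrix ι R) :
    symmPairing Z ⟨_, h⟩ = Z i j + Z j i := by
  rw [symmPairing_apply]
  simp only [Matrix.add_apply, single_apply, add_smul, Finset.sum_add_distrib, ite_smul, one_smul,
    zero_smul, ite_and]
  simp

lemma map_mul_single (A : Matrix κ ι R) (h : Matrix κ ι R →ₗ[R] N) (i j : ι) :
    h (A * single i j (1 : R)) = ∑ k, A k i • h (single k j 1) := by
  have hA : A * single i j (1 : R) = ∑ k, A k i • single k j (1 : R) := by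
    ext k l
    simp only [mul_apply, single_apply, Matrix.sum_apply, Matrix.smul_apply, ite_and]
    simp
  rw [hA, map_sum]
  simp only [map_smul]

include hK in
/-- The cokernel of restriction along `symmMul A` is a symmetric square tensored with `N`. -/
lemma nonempty_symPow_tensor_equiv [Invertible (2 : R)] :
    Nonempty (SymPow R ((ι → R) ⧸ K) 2 ⊗[R] N ≃ₗ[R] SymmMulCoker A N) := by
  obtain ⟨C, hC⟩ := exists_formClass_quotient A N hK
  have hsymm (m m' : (ι → R) ⧸ K) : C m m' = C m' m := by
    obtain ⟨f, rfl⟩ := K.mkQ_surjective m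
    obtain ⟨f', rfl⟩ := K.mkQ_surjective m'
    rw [hC, hC, formClass_comm]
  have hΘ (Z : ι → ι → N) : TensorProduct.lift (symSqLift C hsymm) (symSqCoord N K Z) =
      Submodule.Quotient.mk (symmPairing Z) := by
    rw [symSqCoord_apply, symmPairing, ← Submodule.mkQ_apply]
    simp only [map_sum, TensorProduct.lift.tmul, symSqLift_mul, hC]
    rfl
  refine ⟨LinearEquiv.ofBijective (TensorProduct.lift (symSqLift C hsymm)) ⟨?_, fun q => ?_⟩⟩
  · rw [injective_iff_map_eq_zero]
    intro s hs
    obtain ⟨Z, rfl⟩ := symSqCoord_surjective s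
    rw [hΘ, Submodule.Quotient.mk_eq_zero] at hs
    obtain ⟨h, hh⟩ := hs
    set V : κ → ι → N := fun k j => h (single k j 1) with hV
    have hZ : Z + (fun i j => Z j i) = (fun i j => ∑ k, A k i • V k j) +
        fun i j => ∑ k, A k j • V k i := by
      ext i j
      have hij : single i j 1 + single j i 1 ∈ symmMatrix ι R := by
        rw [mem_symmMatrix]; simp [add_comm]
      have := (LinearMap.congr_fun hh ⟨_, hij⟩).trans (symmPairing_single Z i j hij)
      rw [LinearMap.lcomp_apply, symmMul_apply, Matrix.mul_add, map_add, map_mul_single,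
        map_mul_single] at this
      exact this.symm
    have := congrArg (symSqCoord N K) hZ
    rw [map_add, map_add, symSqCoord_transpose Z, symSqCoord_transpose
      (fun i j => ∑ k, A k i • V k j), symSqCoord_mulVec hK, add_zero, ← two_smul R] at this
    exact (isUnit_of_invertible (2 : R)).smul_eq_zero.1 this
  · obtain ⟨g, rfl⟩ := Submodule.Quotient.mk_surjective _ q
    obtain ⟨Z, rfl⟩ := symmPairing_surjective g
    exact ⟨_, hΘ Z⟩

end SymmetricSquareOfCokernel

section CodimensionThree

variable {R : Type} [CommRing R] [Invertible (2 : R)] {ι κ : Type} [Fintype ι] [DecidableEq ι]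
  [Fintype κ] [DecidableEq κ] {A : Matrix κ ι R} (e₀ : ι ⊕ Fin 2 ≃ κ) {x y z : R}
  (hreg : Regular₃ x y z R) (hx : x ∈ minorIdeal A) (hy : y ∈ minorIdeal A)
  (hz : z ∈ minorIdeal A)

include e₀ in
/-- The augmentation onto the ideal of maximal minors. -/
lemma exists_augmentation : ∃ ε : skewMatrix κ R →ₗ[R] minorIdeal A, Function.Surjective ε ∧
    ∀ Y, (ε Y : R) = skewTrace (complMinor A e₀) Y := by
  refine ⟨(skewTrace (complMinor A e₀)).codRestrict _ fun Y => ?_, ?_, fun _ => rfl⟩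
  · rw [← range_skewTrace e₀]
    exact ⟨Y, rfl⟩
  · rintro ⟨r, hr⟩
    rw [← range_skewTrace e₀] at hr
    obtain ⟨Y, rfl⟩ := hr
    exact ⟨Y, rfl⟩

include e₀ hreg hx hy hz

lemma nonempty_ext_minorIdeal_iso {K : Submodule R (ι → R)}
    (hK : K = LinearMap.range (Aᵀ).mulVecLin) :
    Nonempty (ExtM R 1 (minorIdeal A) (R ⧸ minorIdeal A) ≅
      ExtM R 2 (minorIdeal A) (minorIdeal A)) ∧
    Nonempty (ExtM R 2 (minorIdeal A) (minorIdeal A) ≅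
      ModuleCat.of R (SymPow R ((ι → R) ⧸ K) 2 ⊗[R] minorIdeal A)) := by
  obtain ⟨ε, hε, hεY⟩ := exists_augmentation (A := A) e₀
  have h₁ : Function.Exact (skewMulTranspose A) ε := fun Y => by
    rw [← exact_skewMulTranspose hreg hx hy hz e₀ Y, ← hεY, ZeroMemClass.coe_eq_zero]
  have h₂ := exact_symmMul hreg hx hy
  have hinj := symmMul_injective hreg hx
  have : Module.Projective R (Matrix κ ι R) := inferInstanceAs (Module.Projective R (κ → ι → R))
  obtain ⟨f⟩ := nonempty_ext_one_iso (R ⧸ minorIdeal A) ε _ _ hε h₁ h₂ hinj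
  obtain ⟨g⟩ := nonempty_ext_two_iso (minorIdeal A) ε _ _ hε h₁ h₂ hinj
  obtain ⟨e⟩ := nonempty_quotient_equiv (minorIdeal A) (minorIdeal A).mkQ
    (minorIdeal A).mkQ_surjective (fun _ => Submodule.Quotient.mk_eq_zero _) (skewMulTranspose A)
    (symmMul A) (symmMul_comp A)
    (exists_comp_skewMulTranspose (exact_symmTransposeMul hreg hx hy hz e₀))
    (exists_apply_symmMul_eq e₀)
  obtain ⟨θ⟩ := nonempty_symPow_tensor_equiv (N := minorIdeal A) hK
  exact ⟨⟨f ≪≫ e.toModuleIso ≪≫ g.symm⟩, ⟨g ≪≫ θ.symm.toModuleIso⟩⟩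

end CodimensionThree

lemma minors_eq_minorIdeal {k : Type} [Field k] {n t : ℕ}
    (A : Matrix (Fin (t + 2)) (Fin t) (RR k n)) : minors A t = minorIdeal A := by
  refine le_antisymm (Submodule.span_le.2 ?_) (Submodule.span_le.2 ?_)
  · rintro _ ⟨r, c, hr, hc, rfl⟩
    obtain ⟨e, rfl⟩ := exists_equiv_comp_inl_eq finSumFinEquiv hr
    have hdet := det_permute' (Equiv.ofBijective c (Finite.injective_iff_bijective.1 hc))
      (A.submatrix (e ∘ Sum.inl) id)
    rw [submatrix_submatrix] at hdet
    change (A.submatrix (e ∘ Sum.inl) c).det = _ at hdet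
    rw [SetLike.mem_coe, hdet]
    exact Ideal.mul_mem_left _ _ (Submodule.subset_span ⟨e, rfl⟩)
  · rintro _ ⟨e, rfl⟩
    exact Submodule.subset_span
      ⟨_, _, e.injective.comp Sum.inl_injective, Function.injective_id, rfl⟩


/-- equation `S2MotimesI`; c = 3.
If `B_t = R/I_t(φ)` is standard determinantal of codimension `3`, then
`Ext¹_R(I_t(φ), B_t) ≅ Ext²_R(I_t(φ), I_t(φ)) ≅ S₂M(ℓ₃) ⊗_R I_t(φ)`
(twists invisible on underlying modules). -/
theorem statement_10 {k : Type} [Field k] [IsAlgClosed k] [CharZero k]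
    {n t : ℕ}
    (A : Matrix (Fin (t + 2)) (Fin t) (RR k n))
    (a : Fin (t + 2) → ℤ) (b : Fin t → ℤ)
    (hhom : IsHomogMatrix A a b)
    (hdet : depthEQ (minors A t) (RR k n) 3) :
    misoM (ExtM (RR k n) 1 ↥(minors A t) (RR k n ⧸ minors A t))
      (ExtM (RR k n) 2 ↥(minors A t) ↥(minors A t)) ∧
    misoM (ExtM (RR k n) 2 ↥(minors A t) ↥(minors A t))
      (ModuleCat.of (RR k n)
        ((SymPow (RR k n) (Mdl A) 2) ⊗[RR k n] ↥(minors A t))) := by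
  obtain ⟨⟨rs, hlen, hmem, hrs⟩, -⟩ := hdet
  obtain ⟨x, y, z, rfl⟩ := List.length_eq_three.1 hlen
  have h2 : (2 : RR k n) * MvPolynomial.C 2⁻¹ = 1 := by
    rw [← map_ofNat MvPolynomial.C 2, ← map_mul, mul_inv_cancel₀ two_ne_zero, map_one]
  let : Invertible (2 : RR k n) := ⟨_, (mul_comm _ _).trans h2, h2⟩
  rw [minors_eq_minorIdeal] at hmem ⊢
  exact nonempty_ext_minorIdeal_iso finSumFinEquiv (.of_isWeaklyRegular hrs.toIsWeaklyRegular)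
    (hmem x (by simp)) (hmem y (by simp)) (hmem z (by simp)) rfl

end KMR
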